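/- Main theorem (matroid-colorful Goodman–Pollack–Wenger): Let F be a finite family of convex sets in ℝ^d and μ : 2^F → ℕ the rank function of a loopless matroid on F. Suppose for some 0 ≤ k < d there is a function φ : F → ℝ^k such that conv G₁ ∩ conv G₂ = ∅ implies conv φ(G₁) ∩ conv φ(G₂) = ∅ whenever G₁ ∪ G₂ ⊆ F satisfies μ(G₁ ∪ G₂) = |G₁| + |G₂| (with G₁, G₂ disjoint). Then there exists a subfamily G ⊆ F with μ(F \ G) ≤ k+1 that has a hyperplane transversal. -/

import Mathlib

open RealInnerProductSpace

/-- `μ : 2^E → ℕ` is the rank function of a matroid. -/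
def IsMatroidRankFn {α : Type*} [DecidableEq α] (μ : Finset α → ℕ) : Prop :=
  μ ∅ = 0 ∧
  (∀ (A : Finset α) (x : α), μ A ≤ μ (insert x A) ∧ μ (insert x A) ≤ μ A + 1) ∧
  (∀ A B : Finset α, μ (A ∪ B) + μ (A ∩ B) ≤ μ A + μ B)


namespace GPW

open scoped List

/-- Mod 2 chains of ordered simplices, represented by lists of vertices. -/
abbrev Ch (α : Type*) := List α →₀ ZMod 2

noncomputable section

abbrev dl {α : Type*} (l : List α) : Ch α := Finsupp.single l 1

abbrev Sp {α : Type*} (P : List α → Prop) : Submodule (ZMod 2) (Ch α) :=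
  Finsupp.supported (ZMod 2) (ZMod 2) {l | P l}

def lin {α β : Type*} (f : List α → Ch β) : Ch α →ₗ[ZMod 2] Ch β :=
  Finsupp.linearCombination (ZMod 2) f

@[simp] lemma lin_dl {α β : Type*} (f : List α → Ch β) (l : List α) : lin f (dl l) = f l := by
  simp [lin, dl]

def cone {α : Type*} (a : α) : Ch α →ₗ[ZMod 2] Ch α :=
  Finsupp.lmapDomain (ZMod 2) (ZMod 2) (List.cons a)

@[simp] lemma cone_dl {α : Type*} (a : α) (l : List α) : cone a (dl l) = dl (a :: l) := by
  simp [cone, dl]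

def mp {α β : Type*} (f : α → β) : Ch α →ₗ[ZMod 2] Ch β :=
  Finsupp.lmapDomain (ZMod 2) (ZMod 2) (List.map f)

@[simp] lemma mp_dl {α β : Type*} (f : α → β) (l : List α) : mp f (dl l) = dl (l.map f) := by
  simp [mp, dl]

def bdL {α : Type*} : List α → Ch α
  | [] => 0
  | a :: l => dl l + cone a (bdL l)

def bd {α : Type*} : Ch α →ₗ[ZMod 2] Ch α := lin bdL

@[simp] lemma bd_dl {α : Type*} (l : List α) : bd (dl l) = bdL l := lin_dl _ _

lemma add_self' {α : Type*} (c : Ch α) : c + c = 0 := ZModModule.add_self c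

lemma eq_of_add {α : Type*} {c d : Ch α} (h : c + d = 0) : c = d := by
  have := congrArg (· + d) h
  simpa [add_assoc, add_self'] using this

lemma hom_ext {α : Type*} {M : Type*} [AddCommMonoid M] [Module (ZMod 2) M]
    {F G : Ch α →ₗ[ZMod 2] M} (h : ∀ l, F (dl l) = G (dl l)) : F = G := by
  apply Finsupp.lhom_ext'
  intro l
  ext
  simpa using h l

lemma dl_mem {α : Type*} {P : List α → Prop} {l : List α} (h : P l) : dl l ∈ Sp P :=
  Finsupp.single_mem_supported _ _ h

lemma map_mem {α : Type*} {M : Type*} [AddCommMonoid M] [Module (ZMod 2) M]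
    {P : List α → Prop} {N : Submodule (ZMod 2) M} {F : Ch α →ₗ[ZMod 2] M}
    (h : ∀ l, P l → F (dl l) ∈ N) {c : Ch α} (hc : c ∈ Sp P) : F c ∈ N := by
  have : Sp P ≤ N.comap F := by
    rw [Sp, Finsupp.supported_eq_span_single, Submodule.span_le]
    rintro _ ⟨l, hl, rfl⟩
    exact h l hl
  exact this hc

lemma map_eq {α : Type*} {M : Type*} [AddCommMonoid M] [Module (ZMod 2) M]
    {P : List α → Prop} {F G : Ch α →ₗ[ZMod 2] M}
    (h : ∀ l, P l → F (dl l) = G (dl l)) {c : Ch α} (hc : c ∈ Sp P) : F c = G c := by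
  have : Sp P ≤ LinearMap.eqLocus F G := by
    rw [Sp, Finsupp.supported_eq_span_single, Submodule.span_le]
    rintro _ ⟨l, hl, rfl⟩
    exact h l hl
  exact this hc

lemma Sp_mono {α : Type*} {P Q : List α → Prop} (h : ∀ l, P l → Q l) {c : Ch α}
    (hc : c ∈ Sp P) : c ∈ Sp Q := Finsupp.supported_mono (fun l hl => h l hl) hc

lemma Sp_false {α : Type*} {P : List α → Prop} (h : ∀ l, ¬ P l) {c : Ch α}
    (hc : c ∈ Sp P) : c = 0 := by
  have : {l | P l} = ∅ := by ext l; simp [h l]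
  rw [Sp, this] at hc
  simpa using hc

lemma bd_cone {α : Type*} (a : α) (c : Ch α) : bd (cone a c) = c + cone a (bd c) := by
  have : bd ∘ₗ cone a = LinearMap.id + cone a ∘ₗ bd := hom_ext (by intro l; simp [bdL])
  exact LinearMap.congr_fun this c

lemma bd_bdL {α : Type*} (l : List α) : bd (bdL l) = 0 := by
  induction l with
  | nil => simp [bdL]
  | cons a l ih => simp [bdL, bd_cone, ih, add_self']

lemma bd_bd {α : Type*} (c : Ch α) : bd (bd c) = 0 := by
  have : bd ∘ₗ bd = (0 : Ch α →ₗ[ZMod 2] Ch α) := hom_ext (by intro l; simp [bd_bdL])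
  exact LinearMap.congr_fun this c

lemma mp_cone {α β : Type*} (f : α → β) (a : α) (c : Ch α) :
    mp f (cone a c) = cone (f a) (mp f c) := by
  have : mp f ∘ₗ cone a = cone (f a) ∘ₗ mp f := hom_ext (by intro l; simp)
  exact LinearMap.congr_fun this c

lemma mp_bdL {α β : Type*} (f : α → β) (l : List α) : mp f (bdL l) = bdL (l.map f) := by
  induction l with
  | nil => simp [bdL]
  | cons a l ih => simp [bdL, mp_cone, ih]

lemma mp_bd {α β : Type*} (f : α → β) (c : Ch α) : mp f (bd c) = bd (mp f c) := by
  have : mp f ∘ₗ bd = bd ∘ₗ mp f := hom_ext (by intro l; simp [mp_bdL])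
  exact LinearMap.congr_fun this c

lemma mp_mp {α β γ : Type*} (f : α → β) (g : β → γ) (c : Ch α) :
    mp g (mp f c) = mp (g ∘ f) c := by
  have : mp g ∘ₗ mp f = mp (g ∘ f) := hom_ext (by intro l; simp)
  exact LinearMap.congr_fun this c

lemma bdL_mem {α : Type*} (l : List α) :
    bdL l ∈ Sp (fun l' => l' <+ l ∧ l'.length + 1 = l.length) := by
  induction l with
  | nil => simp [bdL]
  | cons a l ih =>
    refine Submodule.add_mem _ (dl_mem ⟨List.sublist_cons_self a l, rfl⟩) ?_
    refine map_mem (fun l' h => ?_) ih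
    rw [cone_dl]
    exact dl_mem ⟨h.1.cons_cons a, by simp [h.2]⟩

/-- General subdivision operator. -/
def sdF {α β : Type*} (b : List α → β) : ℕ → List α → Ch β
  | 0, _ => dl []
  | m + 1, l => cone (b l) (lin (sdF b m) (bdL l))

def sdL {α β : Type*} (b : List α → β) (l : List α) : Ch β := sdF b l.length l

def sd {α β : Type*} (b : List α → β) : Ch α →ₗ[ZMod 2] Ch β := lin (sdL b)

@[simp] lemma sd_dl {α β : Type*} (b : List α → β) (l : List α) : sd b (dl l) = sdL b l :=
  lin_dl _ _

@[simp] lemma sdL_nil {α β : Type*} (b : List α → β) : sdL b [] = dl [] := rfl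

lemma sdL_eq {α β : Type*} (b : List α → β) (l : List α) (hl : l ≠ []) :
    sdL b l = cone (b l) (sd b (bdL l)) := by
  obtain ⟨a, t, rfl⟩ := List.exists_cons_of_ne_nil hl
  have : lin (sdF b t.length) (bdL (a :: t)) = sd b (bdL (a :: t)) := by
    refine map_eq (fun l' h => ?_) (bdL_mem (a :: t))
    have : l'.length = t.length := by simpa using h.2
    simp [sdL, this]
  rw [← this]
  rfl

lemma sd_bdL {α β : Type*} (b : List α → β) (m : ℕ) :
    ∀ l : List α, l.length = m → bd (sdL b l) = sd b (bdL l) := by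
  induction m with
  | zero =>
    intro l hl
    have : l = [] := by simpa using hl
    subst this
    simp [bdL]
  | succ m ih =>
    intro l hl
    have hne : l ≠ [] := by rintro rfl; simp at hl
    rw [sdL_eq b l hne, bd_cone]
    have : bd (sd b (bdL l)) = sd b (bd (bdL l)) := by
      refine map_eq (F := bd ∘ₗ sd b) (G := sd b ∘ₗ bd) (fun l' h => ?_) (bdL_mem l)
      simp [ih l' (by omega)]
    rw [this, bd_bdL]; simp

lemma sd_bd {α β : Type*} (b : List α → β) (c : Ch α) : sd b (bd c) = bd (sd b c) := by
  have : sd b ∘ₗ bd = bd ∘ₗ sd b := hom_ext (by intro l; simp [sd_bdL b _ l rfl])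
  exact LinearMap.congr_fun this c

lemma sdL_mp {α β : Type*} (b : List α → β) (f : α → α) (g : β → β)
    (h : ∀ l, l ≠ [] → b (l.map f) = g (b l)) (m : ℕ) :
    ∀ l : List α, l.length = m → sdL b (l.map f) = mp g (sdL b l) := by
  induction m with
  | zero =>
    intro l hl
    have : l = [] := by simpa using hl
    subst this
    simp
  | succ m ih =>
    intro l hl
    have hne : l ≠ [] := by rintro rfl; simp at hl
    rw [sdL_eq b l hne, sdL_eq b _ (by simpa using hne), mp_cone, h l hne, ← mp_bdL]
    congr 1
    refine map_eq (F := sd b ∘ₗ mp f) (G := mp g ∘ₗ sd b) (fun l' h => ?_) (bdL_mem l)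
    simp [ih l' (by omega)]

lemma sd_mp {α β : Type*} (b : List α → β) (f : α → α) (g : β → β)
    (h : ∀ l, l ≠ [] → b (l.map f) = g (b l)) (c : Ch α) : sd b (mp f c) = mp g (sd b c) := by
  have : sd b ∘ₗ mp f = mp g ∘ₗ sd b := hom_ext (by intro l; simp [sdL_mp b f g h _ l rfl])
  exact LinearMap.congr_fun this c

lemma sdL_mem {α β : Type*} (b : List α → β) (R : List α → List β → Prop) (h0 : R [] [])
    (h1 : ∀ l, l ≠ [] → ∀ l', l' <+ l → l'.length + 1 = l.length → ∀ t, R l' t → R l (b l :: t))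
    (m : ℕ) : ∀ l : List α, l.length = m → sdL b l ∈ Sp (R l) := by
  induction m with
  | zero =>
    intro l hl
    have : l = [] := by simpa using hl
    subst this
    exact dl_mem h0
  | succ m ih =>
    intro l hl
    have hne : l ≠ [] := by rintro rfl; simp at hl
    rw [sdL_eq b l hne]
    refine map_mem (P := fun t => R l (b l :: t)) (fun t ht => ?_) ?_
    · rw [cone_dl]; exact dl_mem ht
    · refine map_mem (fun l' h => ?_) (bdL_mem l)
      rw [sd_dl]
      exact Sp_mono (fun t ht => h1 l hne l' h.1 h.2 t ht) (ih l' (by omega))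

/-- A sequence of chains witnessing that the `ℤ/2`-index is at least `n`. -/
def HasIdx {α : Type*} (τ : α → α) (P : List α → Prop) (n : ℕ) : Prop :=
  ∃ c : ℕ → Ch α, (∀ m ≤ n, c m ∈ Sp (fun l => P l ∧ l.length = m + 1)) ∧
    bd (c 0) = dl [] ∧ ∀ m < n, bd (c (m + 1)) = c m + mp τ (c m)

lemma HasIdx.refine {α : Type*} {τ : α → α} {P : List α → Prop} {n : ℕ} (h : HasIdx τ P n)
    {κ : Type*} (F : Filter κ) [F.NeBot] (R : κ → List α → Prop) (T : κ → Prop)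
    (hT : ∀ᶠ x in F, T x) (hR : ∀ l, P l → ∀ᶠ x in F, R x l) :
    ∃ x, T x ∧ HasIdx τ (fun l => P l ∧ R x l) n := by
  obtain ⟨c, hc, h0, h1⟩ := h
  have key : ∀ᶠ x in F, ∀ m ∈ Finset.range (n + 1), ∀ l ∈ (c m).support, R x l := by
    rw [Filter.eventually_all_finset]
    intro m hm
    rw [Filter.eventually_all_finset]
    intro l hl
    exact hR l ((hc m (by simpa [Nat.lt_succ_iff] using hm)) hl).1
  obtain ⟨x, hx, hx'⟩ := (hT.and key).exists
  refine ⟨x, hx, c, fun m hm => ?_, h0, h1⟩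
  intro l hl
  exact ⟨⟨((hc m hm) hl).1, hx' m (by simpa [Nat.lt_succ_iff] using hm) l hl⟩, ((hc m hm) hl).2⟩

/-- Pushing forward along a (partial) equivariant chain map. -/
lemma HasIdx.map {α β : Type*} {τ : α → α} {τ' : β → β} {P : List α → Prop}
    {P' : List β → Prop} {n : ℕ} (h : HasIdx τ P n) (F : Ch α →ₗ[ZMod 2] Ch β)
    (hnil : F (dl []) = dl [])
    (hbd : ∀ l, P l → l.length ≤ n + 1 → F (bdL l) = bd (F (dl l)))
    (hτ : ∀ l, P l → l.length ≤ n + 1 → l ≠ [] → F (dl (l.map τ)) = mp τ' (F (dl l)))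
    (hP : ∀ l, P l → l.length ≤ n + 1 → l ≠ [] →
      F (dl l) ∈ Sp (fun t => P' t ∧ t.length = l.length)) :
    HasIdx τ' P' n := by
  obtain ⟨c, hc, h0, h1⟩ := h
  have hb : ∀ m ≤ n, F (bd (c m)) = bd (F (c m)) := by
    intro m hm
    refine map_eq (F := F ∘ₗ bd) (G := bd ∘ₗ F) (fun l h => ?_) (hc m hm)
    simpa using hbd l h.1 (by omega)
  refine ⟨fun m => F (c m), fun m hm => ?_, ?_, fun m hm => ?_⟩
  · refine map_mem (fun l h => ?_) (hc m hm)
    have := hP l h.1 (by omega) (by rintro rfl; simp at h)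
    rwa [h.2] at this
  · rw [← hb 0 (Nat.zero_le n), h0, hnil]
  · rw [← hb (m + 1) hm, h1 m hm, map_add]
    congr 1
    refine map_eq (F := F ∘ₗ mp τ) (G := mp τ' ∘ₗ F) (fun l h => ?_) (hc m hm.le)
    simpa using hτ l h.1 (by omega) (by rintro rfl; simp at h)

lemma HasIdx.mono {α : Type*} {τ : α → α} {P P' : List α → Prop} {n : ℕ} (h : HasIdx τ P n)
    (hP : ∀ l, P l → P' l) : HasIdx τ P' n := by
  obtain ⟨c, hc, h0, h1⟩ := h
  exact ⟨c, fun m hm => Sp_mono (fun l h => ⟨hP l h.1, h.2⟩) (hc m hm), h0, h1⟩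

lemma HasIdx.sd {α β : Type*} {τ : α → α} {τ' : β → β} {P : List α → Prop}
    {n : ℕ} (h : HasIdx τ P n) (b : List α → β)
    (hτ : ∀ l, l ≠ [] → b (l.map τ) = τ' (b l)) (R : List α → List β → Prop) (hR0 : R [] [])
    (hR : ∀ l, l ≠ [] → ∀ l', l' <+ l → l'.length + 1 = l.length → ∀ t, R l' t → R l (b l :: t)) :
    HasIdx τ' (fun t => ∃ l, P l ∧ t.length = l.length ∧ l.length ≤ n + 1 ∧ R l t) n := by
  refine h.map (GPW.sd b) (by simp) (fun l _ _ => by rw [← bd_dl, sd_bd])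
    (fun l _ _ _ => ?_) (fun l hl hl' _ => ?_)
  · rw [← mp_dl, sd_mp b τ τ' hτ]
  · rw [sd_dl]
    refine Sp_mono (fun t ht => ?_) (sdL_mem b (fun l t => R l t ∧ t.length = l.length)
      ⟨hR0, rfl⟩ (fun l hl l' h1 h2 t ht => ⟨hR l hl l' h1 h2 t ht.1, ?_⟩) _ l rfl)
    · exact ⟨⟨l, hl, ht.2, hl', ht.1⟩, ht.2⟩
    · simp [ht.2, h2]

end
end GPW

namespace GPW
open scoped List
noncomputable section

/-! ### Equivariant choice -/

lemma equivariant_choice {D Y : Type*} (τ : D → D) (σ : Y → Y) (hτ : ∀ d, τ (τ d) = d)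
    (hσ : ∀ y, σ (σ y) = y) (V : D → Prop) (hV : ∀ d, V d → V (τ d)) (hfree : ∀ d, V d → τ d ≠ d)
    (R : D → Y → Prop) (hR : ∀ d y, V d → R d y → R (τ d) (σ y)) (hex : ∀ d, V d → ∃ y, R d y)
    [Nonempty Y] :
    ∃ f : D → Y, ∀ d, V d → R d (f d) ∧ f (τ d) = σ (f d) := by
  classical
  let _ : LinearOrder D := linearOrderOfSTO (WellOrderingRel (α := D))
  choose! g hg using hex
  refine ⟨fun d => if d < τ d then g d else σ (g (τ d)), fun d hd => ⟨?_, ?_⟩⟩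
  · dsimp only
    split_ifs with h
    · exact hg d hd
    · simpa [hτ] using hR (τ d) _ (hV d hd) (hg _ (hV d hd))
  · dsimp only
    rw [hτ]
    rcases lt_or_gt_of_ne (hfree d hd) with h | h
    · rw [if_pos h, if_neg (not_lt.2 h.le), hσ]
    · rw [if_neg (not_lt.2 h.le), if_pos h]

/-! ### The parity cochains -/

def wth {α : Type*} (s : α → ZMod 2) : List α → ZMod 2 × ZMod 2
  | [] => (0, 1)
  | a :: l => (s a * (wth s l).1 + (wth s l).2, s a * ((wth s l).1 + (wth s l).2))

def W {α : Type*} (s : α → ZMod 2) : Ch α →ₗ[ZMod 2] ZMod 2 :=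
  Finsupp.linearCombination (ZMod 2) (fun l => (wth s l).1)

def Th {α : Type*} (s : α → ZMod 2) : Ch α →ₗ[ZMod 2] ZMod 2 :=
  Finsupp.linearCombination (ZMod 2) (fun l => (wth s l).2)

@[simp] lemma W_dl {α : Type*} (s : α → ZMod 2) (l : List α) : W s (dl l) = (wth s l).1 := by
  simp [W, dl]

@[simp] lemma Th_dl {α : Type*} (s : α → ZMod 2) (l : List α) : Th s (dl l) = (wth s l).2 := by
  simp [Th, dl]

lemma W_cone {α : Type*} (s : α → ZMod 2) (a : α) (c : Ch α) :
    W s (cone a c) = s a * W s c + Th s c := by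
  have : W s ∘ₗ cone a = s a • W s + Th s := hom_ext (by intro l; simp [wth])
  exact LinearMap.congr_fun this c

lemma Th_cone {α : Type*} (s : α → ZMod 2) (a : α) (c : Ch α) :
    Th s (cone a c) = s a * (W s c + Th s c) := by
  have : Th s ∘ₗ cone a = s a • (W s + Th s) := hom_ext (by intro l; simp [wth, mul_add])
  exact LinearMap.congr_fun this c

lemma W_Th_bdL {α : Type*} (s : α → ZMod 2) (l : List α) :
    W s (bdL l) = 0 ∧ Th s (bdL l) = W s (dl l) := by
  induction l with
  | nil => simp [bdL, wth]
  | cons a l ih =>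
    simp only [bdL, map_add, W_cone, Th_cone, ih.1, ih.2, W_dl, Th_dl, wth]
    refine ⟨?_, by ring⟩
    rw [mul_zero, zero_add, CharTwo.add_self_eq_zero]

lemma Th_bd {α : Type*} (s : α → ZMod 2) (c : Ch α) : Th s (bd c) = W s c := by
  have : Th s ∘ₗ bd = W s := hom_ext (by intro l; simpa using (W_Th_bdL s l).2)
  exact LinearMap.congr_fun this c

lemma wth_tau {α : Type*} (s : α → ZMod 2) (τ : α → α) (l : List α)
    (h : ∀ a ∈ l, s (τ a) = s a + 1) :
    (wth s (l.map τ)).1 = (wth s l).1 ∧ (wth s l).2 + (wth s (l.map τ)).2 = (wth s l).1 := by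
  induction l with
  | nil => simp [wth, CharTwo.add_self_eq_zero]
  | cons a l ih =>
    obtain ⟨h1, h2⟩ := ih (fun b hb => h b (List.mem_cons_of_mem _ hb))
    have h3 := h a (by simp)
    simp only [List.map_cons, wth, h3, h1]
    generalize (wth s l).1 = x at *
    generalize (wth s l).2 = y at *
    generalize (wth s (l.map τ)).2 = z at *
    generalize s a = u at *
    clear h3 h1 ih h
    revert x y z u
    decide

lemma wth_chain {β : Type*} [DecidableEq β] (s : Finset β → ZMod 2) (l : List (Finset β))
    (hne : ∀ q ∈ l, q.Nonempty) (hch : l.Pairwise (fun a b => b ⊆ a)) :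
    (wth s l ≠ 0) → ∀ q ∈ l.head?, l.length ≤ q.card := by
  induction l with
  | nil => simp
  | cons a l ih =>
    intro h q hq
    simp only [List.head?_cons, Option.mem_def, Option.some.injEq] at hq
    subst hq
    have hl : wth s l ≠ 0 := by
      intro h0; apply h; simp [wth, h0]
    have ih' := ih (fun q hq => hne q (List.mem_cons_of_mem _ hq)) (List.pairwise_cons.1 hch).2 hl
    cases l with
    | nil => simpa using (hne a (by simp)).card_pos
    | cons b t =>
      have hb := ih' b (by simp)
      have hba : b ⊆ a := (List.pairwise_cons.1 hch).1 b (by simp)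
      have hne' : b ≠ a := by
        rintro rfl
        apply h
        simp only [wth]
        generalize s b = u
        generalize wth s t = x
        clear * -
        revert u x
        decide
      have := Finset.card_lt_card (hba.ssubset_of_ne hne')
      simp only [List.length_cons] at *
      omega

/-- The index of a poset of height at most `n` is less than `n`. -/
lemma no_idx_poset {β : Type*} [DecidableEq β] {n : ℕ} (τ : Finset β → Finset β)
    (hτ : ∀ q, τ (τ q) = q) (P : List (Finset β) → Prop)
    (hP : ∀ l, P l → (∀ q ∈ l, q.Nonempty ∧ q.card ≤ n ∧ τ q ≠ q) ∧
      l.Pairwise (fun a b => b ⊆ a)) : ¬ HasIdx τ P n := by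
  rintro ⟨c, hc, h0, h1⟩
  obtain ⟨s, hs⟩ := equivariant_choice τ (fun y : ZMod 2 => y + 1) hτ (by decide)
    (fun q => τ q ≠ q) (fun q h h' => h (by rw [hτ] at h'; exact h'.symm)) (fun q h => h)
    (fun _ _ => True) (by simp) (by simp)
  have key : ∀ m ≤ n, W s (c m) = 1 := by
    intro m
    induction m with
    | zero =>
      intro _
      rw [← Th_bd, h0]; simp [wth]
    | succ m ih =>
      intro hm
      rw [← Th_bd, h1 m hm, ← ih (by omega)]
      refine map_eq (F := Th s ∘ₗ (LinearMap.id + mp τ)) (G := W s) (fun l h => ?_) (hc m (by omega))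
      have := (wth_tau s τ l (fun a ha => (hs a ((hP l h.1).1 a ha).2.2).2)).2
      simpa using this
  have h2 := key n le_rfl
  have h3 : W s (c n) ∈ (⊥ : Submodule (ZMod 2) (ZMod 2)) := by
    refine map_mem (fun l h => ?_) (hc n le_rfl)
    rw [W_dl, Submodule.mem_bot]
    by_contra hne
    obtain ⟨hP1, hP2⟩ := hP l h.1
    cases l with
    | nil => simp at h
    | cons a t =>
      have := wth_chain s (a :: t) (fun q hq => (hP1 q hq).1) hP2 (fun h0 => hne (by rw [h0]; rfl))
        a (by simp)
      have h4 := (hP1 a (by simp)).2.1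
      have h5 := h.2
      omega
  rw [Submodule.mem_bot] at h3
  rw [h3] at h2
  exact absurd h2 (by decide)

/-! ### Matroid complexes are acyclic -/

end
end GPW

namespace GPW
open scoped List
noncomputable section

section matroid
variable {ι : Type*} [DecidableEq ι] {μ : Finset ι → ℕ}

lemma rk_mono (hμ : IsMatroidRankFn μ) {A B : Finset ι} (h : A ⊆ B) : μ A ≤ μ B := by
  have : ∀ C : Finset ι, μ A ≤ μ (A ∪ C) := by
    intro C
    induction C using Finset.induction_on with
    | empty => simp
    | insert x C _ ih =>
      rw [Finset.union_insert]
      exact ih.trans (hμ.2.1 _ x).1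
  have h2 := this B
  rwa [Finset.union_eq_right.2 h] at h2

lemma rk_sublist (hμ : IsMatroidRankFn μ) {l₁ l₂ : List ι} (h : l₁ <+ l₂) :
    ∀ J : List ι, μ (J ++ l₂).toFinset + l₁.length ≤ μ (J ++ l₁).toFinset + l₂.length := by
  induction h with
  | slnil => simp
  | @cons l₁ l₂ a h ih =>
    intro J
    have h1 : (J ++ a :: l₂).toFinset = insert a (J ++ l₂).toFinset := by ext; simp
    have := (hμ.2.1 (J ++ l₂).toFinset a).2
    have := ih J
    rw [h1, List.length_cons]; omega
  | @cons_cons l₁ l₂ a h ih =>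
    intro J
    have := ih (J ++ [a])
    simp only [List.append_assoc, List.singleton_append] at this
    simp only [List.length_cons]; omega

lemma rk_le_length (hμ : IsMatroidRankFn μ) (l : List ι) : μ l.toFinset ≤ l.length := by
  have := rk_sublist hμ (List.nil_sublist l) []
  simpa [hμ.1] using this

/-- independence of a list -/
def Ind (μ : Finset ι → ℕ) (l : List ι) : Prop := μ l.toFinset = l.length

lemma Ind.sublist (hμ : IsMatroidRankFn μ) {l₁ l₂ : List ι} (h2 : Ind μ l₂) (h : l₁ <+ l₂) :
    Ind μ l₁ := by
  have := rk_sublist hμ h []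
  have h1 := rk_le_length hμ l₁
  unfold Ind at *
  simp only [List.nil_append] at this
  omega

lemma fill (hμ : IsMatroidRankFn μ) (L : List ι) : L.Nodup → ∀ (I : List ι) (M : ℕ) (z : Ch ι),
    z ∈ Sp (fun l => l <+ L ∧ l.length + 1 = M ∧ Ind μ (I ++ l)) → bd z = 0 →
    I.length + M ≤ μ (I ++ L).toFinset →
    ∃ c ∈ Sp (fun l => l <+ L ∧ l.length = M ∧ Ind μ (I ++ l)), bd c = z := by
  induction L with
  | nil =>
    intro _ I M z hz _ hr
    have := rk_le_length hμ I
    simp only [List.append_nil] at hr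
    have hz0 : z = 0 := Sp_false (fun l h => by have := h.2.1; omega) hz
    exact ⟨0, Submodule.zero_mem _, by simp [hz0]⟩
  | cons e L ih =>
    intro hnd I M z hz hbz hr
    obtain ⟨heL, hndL⟩ := List.nodup_cons.1 hnd
    -- decompose `z`
    obtain ⟨a, ha, b, hb, hab⟩ : ∃ a ∈ Sp (fun l => l <+ L ∧ (l.length + 1) + 1 = M ∧
        Ind μ (I ++ e :: l)), ∃ b ∈ Sp (fun l => l <+ L ∧ l.length + 1 = M ∧ Ind μ (I ++ l)),
        cone e a + b = z := by
      have hz' : z ∈ (Sp (fun l => l <+ L ∧ (l.length + 1) + 1 = M ∧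
        Ind μ (I ++ e :: l))).map (cone e) ⊔ Sp (fun l => l <+ L ∧ l.length + 1 = M ∧
          Ind μ (I ++ l)) := by
        refine map_mem (F := LinearMap.id) (fun l h => ?_) hz
        obtain ⟨h1, h2, h3⟩ := h
        rcases List.sublist_cons_iff.1 h1 with h1 | ⟨r, rfl, h1'⟩
        · exact Submodule.mem_sup_right (dl_mem ⟨h1, h2, h3⟩)
        · refine Submodule.mem_sup_left ⟨dl r, dl_mem ⟨h1', by simpa using h2, h3⟩, by simp⟩
      obtain ⟨y, ⟨a, ha, rfl⟩, b, hb, h⟩ := Submodule.mem_sup.1 hz'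
      exact ⟨a, ha, b, hb, h⟩
    -- consequences of the cycle condition
    have hsum : cone e (bd a) + (a + bd b) = 0 := by
      rw [← hbz, ← hab, map_add, bd_cone]; abel
    have hno : a + bd b ∈ Sp (fun l => e ∉ l) := by
      refine Submodule.add_mem _ (Sp_mono (Q := fun l => e ∉ l) (fun l h he => heL (h.1.subset he)) ha) ?_
      refine map_mem (fun l h => ?_) hb
      rw [bd_dl]
      exact Sp_mono (Q := fun l => e ∉ l) (fun l' h' he => heL (h.1.subset (h'.1.subset he))) (bdL_mem l)
    have hyes : cone e (bd a) ∈ Sp (fun l => e ∈ l) := by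
      refine map_mem (P := fun _ => True) (fun l _ => ?_) (by simp [Sp])
      rw [cone_dl]; exact dl_mem (by simp)
    have hzero : a + bd b = 0 := by
      have h1 : a + bd b ∈ Sp (fun l => e ∈ l) := by
        rw [← eq_of_add hsum]; exact hyes
      have hd : Disjoint (Sp (fun l : List ι => e ∈ l)) (Sp (fun l => e ∉ l)) := by
        apply Finsupp.disjoint_supported_supported
        rw [Set.disjoint_left]
        intro l h h'; exact h' h
      exact Submodule.disjoint_def.1 hd _ h1 hno
    have hab' : bd b = a := (eq_of_add hzero).symm
    have hbda : bd a = 0 := by rw [← hab', bd_bd]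
    have hset : ∀ l : List ι, (I ++ e :: l).toFinset = insert e (I ++ l).toFinset := by
      intro l; ext; simp
    by_cases hcase : I.length + M ≤ μ (I ++ L).toFinset
    · -- fill `a` in the link
      obtain ⟨c₁, hc₁, hbc₁⟩ : ∃ c ∈ Sp (fun l => l <+ L ∧ l.length + 1 = M ∧
          Ind μ (I ++ e :: l)), bd c = a := by
        cases M with
        | zero =>
          have : a = 0 := Sp_false (fun l h => by have := h.2.1; omega) ha
          exact ⟨0, Submodule.zero_mem _, by simp [this]⟩
        | succ M =>
          obtain ⟨c, hc, hbc⟩ := ih hndL (I ++ [e]) M a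
            (Sp_mono (fun l h => ⟨h.1, by have := h.2.1; omega, by simpa using h.2.2⟩) ha) hbda
            (by simp only [List.append_assoc, List.singleton_append, List.length_append,
                  List.length_singleton]
                omega)
          exact ⟨c, Sp_mono (fun l h => ⟨h.1, by have := h.2.1; omega, by simpa using h.2.2⟩) hc,
            hbc⟩
      obtain ⟨c₂, hc₂, hbc₂⟩ := ih hndL I M (b + c₁)
        (Submodule.add_mem _ hb (Sp_mono (fun l h => ⟨h.1, h.2.1, h.2.2.sublist hμ
          ((List.Sublist.refl I).append (List.sublist_cons_self e l))⟩) hc₁))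
        (by rw [map_add, hab', hbc₁, add_self']) hcase
      refine ⟨c₂ + cone e c₁, Submodule.add_mem _
        (Sp_mono (fun l h => ⟨h.1.cons e, h.2⟩) hc₂) ?_, ?_⟩
      · refine map_mem (fun l h => ?_) hc₁
        rw [cone_dl]
        exact dl_mem ⟨h.1.cons_cons e, by simpa using h.2.1, h.2.2⟩
      · rw [map_add, hbc₂, bd_cone, hbc₁, ← hab]
        have := add_self' c₁
        calc b + c₁ + (c₁ + cone e a) = (c₁ + c₁) + (cone e a + b) := by abel
          _ = _ := by rw [this, zero_add]
    · refine ⟨cone e b, ?_, ?_⟩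
      · refine map_mem (fun l h => ?_) hb
        rw [cone_dl]
        refine dl_mem ⟨h.1.cons_cons e, by simpa using h.2.1, ?_⟩
        have h1 := h.2.2
        have h2 := rk_le_length hμ (I ++ e :: l)
        unfold Ind at *
        by_cases hel : e ∈ (I ++ L).toFinset
        · rw [hset, Finset.insert_eq_of_mem hel] at hr
          exact absurd hr hcase
        · have h3 := hμ.2.2 (I ++ L).toFinset (I ++ e :: l).toFinset
          have hlL : ∀ x ∈ l, x ∈ L := fun x hx => h.1.subset hx
          have e1 : (I ++ L).toFinset ∪ (I ++ e :: l).toFinset = (I ++ e :: L).toFinset := by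
            ext x; simp; have := hlL x; tauto
          have e2 : (I ++ L).toFinset ∩ (I ++ e :: l).toFinset = (I ++ l).toFinset := by
            ext x
            have := hlL x
            by_cases hx : x = e
            · subst hx
              simp at hel ⊢
              tauto
            · simp [hx]; tauto
          rw [e1, e2] at h3
          simp only [List.length_append, List.length_cons] at *
          omega
      · rw [bd_cone, hab', ← hab, add_comm]

end matroid

end
end GPW

namespace GPW
open scoped List
noncomputable section

/-! ### Barycentric subdivision -/

section bary
variable {E : Type*} [NormedAddCommGroup E] [NormedSpace ℝ E]

def bary (l : List E) : E := (l.length : ℝ)⁻¹ • l.sum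

def hull (l : List E) : Set E := convexHull ℝ {x | x ∈ l}

lemma hull_mono {l l' : List E} (h : l <+ l') : hull l ⊆ hull l' :=
  convexHull_mono (fun _ hx => h.subset hx)

lemma bary_mem (l : List E) (hl : l ≠ []) : bary l ∈ hull l := by
  have hL : (0 : ℝ) < l.length := by exact_mod_cast List.length_pos_of_ne_nil hl
  have h := (convex_convexHull ℝ {x | x ∈ l}).sum_mem (t := Finset.univ)
    (w := fun _ : Fin l.length => (l.length : ℝ)⁻¹) (z := fun i => l[i])
    (fun _ _ => by positivity) (by simp; field_simp)
    (fun i _ => subset_convexHull ℝ _ (by simp))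
  rw [← Finset.smul_sum] at h
  have h2 : ∑ i : Fin l.length, l[i] = l.sum := by simp
  rw [h2] at h
  exact h

lemma sum_dist (l : List E) (v : E) (D : ℝ) (h : ∀ x ∈ l, dist x v ≤ D) :
    ‖l.sum - (l.length : ℝ) • v‖ ≤ l.length * D := by
  induction l with
  | nil => simp
  | cons a l ih =>
    have h1 := ih (fun x hx => h x (List.mem_cons_of_mem _ hx))
    have h2 := h a (by simp)
    rw [dist_eq_norm] at h2
    have : (a :: l).sum - ((a :: l).length : ℝ) • v
        = (a - v) + (l.sum - (l.length : ℝ) • v) := by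
      simp [add_smul]; abel
    rw [this]
    refine (norm_add_le _ _).trans ?_
    simp only [List.length_cons, Nat.cast_add, Nat.cast_one]
    linarith

lemma bary_dist (l : List E) (v : E) (hv : v ∈ l) (D : ℝ) (h : ∀ x ∈ l, ∀ y ∈ l, dist x y ≤ D)
    (n : ℕ) (hn : l.length ≤ n + 1) :
    dist v (bary l) ≤ (n / (n + 1) : ℝ) * D := by
  have hD : 0 ≤ D := dist_nonneg.trans (h v hv v hv)
  obtain ⟨s, t, rfl⟩ := List.append_of_mem hv
  have h1 := sum_dist s v D (fun x hx => h x (by simp [hx]) v hv)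
  have h2 := sum_dist t v D (fun x hx => h x (by simp [hx]) v hv)
  have hlen : ((s ++ v :: t).length : ℝ) = s.length + t.length + 1 := by
    simp; ring
  have h3 : bary (s ++ v :: t) - v = ((s ++ v :: t).length : ℝ)⁻¹ •
      ((s.sum - (s.length : ℝ) • v) + (t.sum - (t.length : ℝ) • v)) := by
    have hpos : ((s ++ v :: t).length : ℝ) ≠ 0 := by rw [hlen]; positivity
    rw [eq_inv_smul_iff₀ hpos, smul_sub, bary, smul_inv_smul₀ hpos, hlen]
    simp only [List.sum_append, List.sum_cons, add_smul, one_smul]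
    abel
  rw [dist_comm, dist_eq_norm, h3, norm_smul]
  have hn' : (s.length : ℝ) + t.length ≤ n := by
    have : s.length + t.length ≤ n := by simp at hn; omega
    exact_mod_cast this
  set q : ℝ := (s.length : ℝ) + t.length with hq
  have hq0 : 0 ≤ q := by positivity
  have h4 : ‖(s.sum - (s.length : ℝ) • v) + (t.sum - (t.length : ℝ) • v)‖ ≤ q * D := by
    refine (norm_add_le _ _).trans ?_
    rw [hq]; linarith
  rw [hlen, norm_inv, Real.norm_of_nonneg (by positivity)]
  calc (q + 1)⁻¹ * _ ≤ (q + 1)⁻¹ * (q * D) := by gcongr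
    _ = (q / (q + 1)) * D := by ring
    _ ≤ _ := by
      refine mul_le_mul_of_nonneg_right ?_ hD
      rw [div_le_div_iff₀ (by positivity) (by positivity)]
      nlinarith

lemma bary_dist' (l : List E) (v : E) (hv : v ∈ hull l) (D : ℝ)
    (h : ∀ x ∈ l, ∀ y ∈ l, dist x y ≤ D) (n : ℕ) (hn : l.length ≤ n + 1) :
    dist v (bary l) ≤ (n / (n + 1) : ℝ) * D := by
  have : hull l ⊆ Metric.closedBall (bary l) ((n / (n + 1) : ℝ) * D) :=
    convexHull_min (fun x hx => bary_dist l x hx D h n hn) (convex_closedBall _ _)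
  exact this hv

lemma bary_neg (l : List E) : bary (l.map Neg.neg) = - bary l := by
  have : (l.map Neg.neg).sum = - l.sum := by
    induction l with
    | nil => simp
    | cons a l ih => simp [ih]; abel
  simp [bary, this]

lemma HasIdx.bary1 {P : List E → Prop} {n : ℕ} (h : HasIdx Neg.neg P n) :
    HasIdx (Neg.neg : E → E) (fun t => ∃ l, P l ∧ (∀ x ∈ t, x ∈ hull l) ∧
      ∀ D, 0 ≤ D → (∀ x ∈ l, ∀ y ∈ l, dist x y ≤ D) →
        ∀ x ∈ t, ∀ y ∈ t, dist x y ≤ (n / (n + 1) : ℝ) * D) n := by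
  refine (h.sd bary (fun l _ => bary_neg l) (fun l t => l.length ≤ n + 1 → (∀ x ∈ t, x ∈ hull l) ∧
      ∀ D, 0 ≤ D → (∀ x ∈ l, ∀ y ∈ l, dist x y ≤ D) →
        ∀ x ∈ t, ∀ y ∈ t, dist x y ≤ (n / (n + 1) : ℝ) * D) (by simp) ?_).mono ?_
  · intro l hl l' hsub hlen t ht hn
    obtain ⟨h1, h2⟩ := ht (by omega)
    have h1' : ∀ x ∈ t, x ∈ hull l := fun x hx => hull_mono hsub (h1 x hx)
    refine ⟨?_, ?_⟩
    · intro x hx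
      rcases List.mem_cons.1 hx with rfl | hx
      · exact bary_mem l hl
      · exact h1' x hx
    · intro D hD hdist x hx y hy
      rcases List.mem_cons.1 hx with rfl | hx <;> rcases List.mem_cons.1 hy with rfl | hy
      · rw [dist_self]; positivity
      · rw [dist_comm]; exact bary_dist' l y (h1' y hy) D hdist n hn
      · exact bary_dist' l x (h1' x hx) D hdist n hn
      · exact h2 D hD (fun x hx y hy => hdist x (hsub.subset hx) y (hsub.subset hy)) x hx y hy
  · rintro t ⟨l, hl, _, hlen, hR⟩
    exact ⟨l, hl, hR hlen⟩

lemma HasIdx.baryN {P : List E → Prop} {n : ℕ} (h : HasIdx Neg.neg P n) (N : ℕ) :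
    HasIdx (Neg.neg : E → E) (fun t => ∃ l, P l ∧ (∀ x ∈ t, x ∈ hull l) ∧
      ∀ D, 0 ≤ D → (∀ x ∈ l, ∀ y ∈ l, dist x y ≤ D) →
        ∀ x ∈ t, ∀ y ∈ t, dist x y ≤ (n / (n + 1) : ℝ) ^ N * D) n := by
  induction N with
  | zero =>
    refine h.mono (fun l hl => ⟨l, hl, fun x hx => subset_convexHull ℝ _ hx, ?_⟩)
    simp
  | succ N ih =>
    refine ih.bary1.mono ?_
    rintro t ⟨l', ⟨l, hl, h1, h2⟩, h3, h4⟩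
    refine ⟨l, hl, fun x hx => ?_, fun D hD hd x hx y hy => ?_⟩
    · have : hull l' ⊆ hull l := convexHull_min h1 (convex_convexHull _ _)
      exact this (h3 x hx)
    · have := h4 _ (by positivity) (h2 D hD hd) x hx y hy
      rwa [pow_succ', mul_assoc]

lemma HasIdx.small {P : List E → Prop} {n : ℕ} (h : HasIdx Neg.neg P n) {ε : ℝ} (hε : 0 < ε) :
    HasIdx (Neg.neg : E → E) (fun t => ∃ l, P l ∧ (∀ x ∈ t, x ∈ hull l) ∧
      ∀ x ∈ t, ∀ y ∈ t, dist x y < ε) n := by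
  obtain ⟨D, hD, hDi⟩ := h.refine Filter.atTop (fun D l => ∀ x ∈ l, ∀ y ∈ l, dist x y ≤ D)
    (fun D => (0 : ℝ) ≤ D) (Filter.eventually_ge_atTop 0) (fun l _ => by
      have : ∀ᶠ D : ℝ in Filter.atTop, ∀ x ∈ {x | x ∈ l}, ∀ y ∈ {x | x ∈ l}, dist x y ≤ D := by
        have hf : {x | x ∈ l}.Finite := List.finite_toSet l
        rw [Filter.eventually_all_finite hf]
        intro x _
        rw [Filter.eventually_all_finite hf]
        intro y _
        exact Filter.eventually_ge_atTop _
      exact this)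
  have hlim : Filter.Tendsto (fun N : ℕ => (n / (n + 1) : ℝ) ^ N * D) Filter.atTop (nhds (0 * D)) :=
    (tendsto_pow_atTop_nhds_zero_of_lt_one (by positivity)
      (by rw [div_lt_one (by positivity)]; linarith)).mul_const D
  rw [zero_mul] at hlim
  obtain ⟨N, hN⟩ := (hlim.eventually (gt_mem_nhds hε)).exists
  refine (hDi.baryN N).mono ?_
  rintro t ⟨l, ⟨hl, hd⟩, h1, h2⟩
  exact ⟨l, hl, h1, fun x hx y hy => (h2 D hD hd x hx y hy).trans_lt hN⟩

end bary

/-! ### The cross-polytope -/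

section cross
variable (n : ℕ)

def ev (m : ℕ) : Fin (n + 1) → ℝ := fun j => if j.val = m then 1 else 0

def Och : ℕ → Ch (Fin (n + 1) → ℝ)
  | 0 => dl []
  | m + 1 => cone (ev n m) (Och m) + mp Neg.neg (cone (ev n m) (Och m))

lemma mp_neg_neg (c : Ch (Fin (n + 1) → ℝ)) : mp Neg.neg (mp Neg.neg c) = c := by
  have : mp Neg.neg ∘ₗ mp Neg.neg = (LinearMap.id : Ch (Fin (n + 1) → ℝ) →ₗ[ZMod 2] _) :=
    hom_ext (by intro l; simp)
  exact LinearMap.congr_fun this c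

lemma Och_sym (m : ℕ) : Och n m + mp Neg.neg (Och n m) = 0 := by
  cases m with
  | zero => simp [Och, ← Finsupp.single_add, CharTwo.add_self_eq_zero]
  | succ m =>
    simp only [Och, map_add, mp_neg_neg]
    rw [add_comm (mp Neg.neg _) (cone _ _)]
    exact add_self' _

lemma Och_bd (m : ℕ) : bd (Och n m) = 0 := by
  induction m with
  | zero => simp [Och, bdL]
  | succ m ih =>
    simp only [Och, map_add, ← mp_bd, bd_cone, ih, map_zero, add_zero]
    exact Och_sym n m

lemma Och_mem (m : ℕ) : Och n m ∈ Sp (fun l => (∃ s : ℕ → ℝ, (∀ j, s j = 1 ∨ s j = -1) ∧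
    ∀ y ∈ l, ∃ j < m, y = s j • ev n j) ∧ l.length = m) := by
  induction m with
  | zero => exact dl_mem ⟨⟨fun _ => 1, by simp, by simp⟩, rfl⟩
  | succ m ih =>
    have h1 : cone (ev n m) (Och n m) ∈ Sp (fun l => (∃ s : ℕ → ℝ, (∀ j, s j = 1 ∨ s j = -1) ∧
        ∀ y ∈ l, ∃ j < m + 1, y = s j • ev n j) ∧ l.length = m + 1) := by
      refine map_mem (fun l h => ?_) ih
      rw [cone_dl]
      obtain ⟨⟨s, hs, hy⟩, hl⟩ := h
      refine dl_mem ⟨⟨fun j => if j = m then 1 else s j, ?_, ?_⟩, by simp [hl]⟩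
      · intro j; dsimp only; split_ifs
        · simp
        · exact hs j
      · intro y hyl
        rcases List.mem_cons.1 hyl with rfl | hyl
        · exact ⟨m, by omega, by simp⟩
        · obtain ⟨j, hj, rfl⟩ := hy y hyl
          exact ⟨j, by omega, by simp [hj.ne]⟩
    refine Submodule.add_mem _ h1 ?_
    refine map_mem (fun l h => ?_) h1
    rw [mp_dl]
    obtain ⟨⟨s, hs, hy⟩, hl⟩ := h
    refine dl_mem ⟨⟨fun j => - s j, ?_, ?_⟩, by simp [hl]⟩
    · intro j; rcases hs j with h | h <;> simp [h]
    · intro y hyl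
      obtain ⟨y', hy', rfl⟩ := List.mem_map.1 hyl
      obtain ⟨j, hj, rfl⟩ := hy y' hy'
      exact ⟨j, hj, by simp⟩

lemma idx_cross : HasIdx (Neg.neg : (Fin (n + 1) → ℝ) → _)
    (fun l => hull l ⊆ {y | ∑ j, |y j| = 1}) n := by
  refine ⟨fun m => cone (ev n m) (Och n m), fun m hm => ?_, ?_, fun m hm => ?_⟩
  · refine map_mem (fun l h => ?_) (Och_mem n m)
    rw [cone_dl]
    obtain ⟨⟨s, hs, hy⟩, hl⟩ := h
    refine dl_mem ⟨?_, by simp [hl]⟩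
    set s' : ℕ → ℝ := fun j => if j = m then 1 else s j with hs'
    have hs1 : ∀ j, s' j = 1 ∨ s' j = -1 := by
      intro j; simp only [hs']; split_ifs
      · simp
      · exact hs j
    have hy' : ∀ y ∈ ev n m :: l, ∃ j < n + 1, y = s' j • ev n j := by
      intro y hyl
      rcases List.mem_cons.1 hyl with rfl | hyl
      · exact ⟨m, by omega, by simp [hs']⟩
      · obtain ⟨j, hj, rfl⟩ := hy y hyl
        exact ⟨j, by omega, by simp [hs', hj.ne]⟩
    have hcv : Convex ℝ {y : Fin (n + 1) → ℝ | (∀ j : Fin (n + 1), 0 ≤ s' j * y j) ∧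
        ∑ j : Fin (n + 1), s' j * y j = 1} := by
      rintro x ⟨hx1, hx2⟩ y ⟨hy1, hy2⟩ a b ha hb hab
      refine ⟨fun j => ?_, ?_⟩
      · have := mul_nonneg ha (hx1 j)
        have := mul_nonneg hb (hy1 j)
        simp only [Pi.add_apply, Pi.smul_apply, smul_eq_mul]
        nlinarith
      · have : ∀ j : Fin (n + 1), s' j * (a • x + b • y) j = a * (s' j * x j) + b * (s' j * y j) := by
          intro j; simp; ring
        rw [Finset.sum_congr rfl (fun j _ => this j), Finset.sum_add_distrib, ← Finset.mul_sum,
          ← Finset.mul_sum, hx2, hy2]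
        linarith
    have hsub : hull (ev n m :: l) ⊆ {y : Fin (n + 1) → ℝ | (∀ j : Fin (n + 1), 0 ≤ s' j * y j) ∧
        ∑ j : Fin (n + 1), s' j * y j = 1} := by
      refine convexHull_min (fun y hyl => ?_) hcv
      obtain ⟨i, hi, rfl⟩ := hy' y hyl
      have hsq : s' i * s' i = 1 := by rcases hs1 i with h | h <;> simp [h]
      have : ∀ j : Fin (n + 1), s' j * (s' i • ev n i) j = if j = (⟨i, hi⟩ : Fin (n + 1)) then 1 else 0 := by
        intro j
        by_cases hj : j = (⟨i, hi⟩ : Fin (n + 1))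
        · subst hj; simp [ev, hsq]
        · have : (j : ℕ) ≠ i := fun h => hj (Fin.ext h)
          simp [ev, hj, this]
      refine ⟨fun j => ?_, ?_⟩
      · rw [this]; split_ifs <;> simp
      · rw [Finset.sum_congr rfl (fun j _ => this j)]; simp
    intro y hyl
    obtain ⟨h1, h2⟩ := hsub hyl
    have : ∀ j : Fin (n + 1), |y j| = s' j * y j := by
      intro j
      have h := h1 j
      rcases hs1 j with h' | h' <;> rw [h'] at h ⊢
      · rw [abs_of_nonneg (by linarith)]; ring
      · rw [abs_of_nonpos (by linarith)]; ring
    show ∑ j, |y j| = 1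
    rw [Finset.sum_congr rfl (fun j _ => this j), h2]
  · simp [Och, bdL]
  · rw [bd_cone, Och_bd]; simp [Och]

end cross

/-! ### No index `n` in `ℝⁿ \ {0}` -/

def flipB {κ : Type*} (x : κ × Bool) : κ × Bool := (x.1, !x.2)

lemma flipB_flipB {κ : Type*} (x : κ × Bool) : flipB (flipB x) = x := by simp [flipB]

lemma flipB_image {κ : Type*} [DecidableEq κ] (q : Finset (κ × Bool)) (x : κ × Bool) :
    x ∈ q.image flipB ↔ flipB x ∈ q := by
  rw [Finset.mem_image]
  constructor
  · rintro ⟨y, hy, rfl⟩; rwa [flipB_flipB]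
  · intro h; exact ⟨_, h, flipB_flipB x⟩

lemma flipB_ne {κ : Type*} [DecidableEq κ] (q : Finset (κ × Bool)) (hne : q.Nonempty)
    (hc : ∀ x ∈ q, flipB x ∉ q) : q.image flipB ≠ q := by
  intro h
  obtain ⟨x, hx⟩ := hne
  have := (flipB_image q x).1 (by rw [h]; exact hx)
  exact hc x hx this

theorem no_idx (n : ℕ) : ¬ HasIdx (Neg.neg : (Fin n → ℝ) → _) (fun l => (0 : Fin n → ℝ) ∉ hull l) n := by
  intro h
  obtain ⟨ε, hε, h⟩ := h.refine (nhdsWithin (0 : ℝ) (Set.Ioi 0))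
    (fun ε l => ∀ y ∈ hull l, ε < ‖y‖) (fun ε => 0 < ε) self_mem_nhdsWithin (fun l hl => by
      have hcl : IsClosed (hull l) := by
        have hf : {x | x ∈ l}.Finite := List.finite_toSet l
        exact (hf.isCompact_convexHull (𝕜 := ℝ)).isClosed
      obtain ⟨r, hr, hsub⟩ := Metric.isOpen_iff.1 hcl.isOpen_compl 0 hl
      have : ∀ᶠ ε : ℝ in nhdsWithin (0 : ℝ) (Set.Ioi 0), ε < r :=
        mem_nhdsWithin_of_mem_nhds (gt_mem_nhds hr)
      filter_upwards [this] with ε hε y hy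
      by_contra hlt
      exact hsub (by rw [Metric.mem_ball, dist_zero_right]; linarith) hy)
  have h2 := h.small hε
  let q : List (Fin n → ℝ) → Finset (Fin n × Bool) := fun l =>
    Finset.univ.filter (fun x => ∃ y ∈ l, ε < if x.2 then y x.1 else - y x.1)
  have hqm : ∀ l x, x ∈ q l ↔ ∃ y ∈ l, ε < if x.2 then y x.1 else - y x.1 := by
    intro l x; simp [q]
  have hmono : ∀ l l', l <+ l' → q l ⊆ q l' := by
    intro l l' hs x hx
    obtain ⟨y, hy, hxy⟩ := (hqm l x).1 hx
    exact (hqm l' x).2 ⟨y, hs.subset hy, hxy⟩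
  have h3 := h2.sd q (τ' := fun s => s.image flipB) (fun l _ => by
      ext ⟨j, b⟩
      rw [flipB_image, hqm, hqm]
      simp only [flipB, List.mem_map, exists_exists_and_eq_and]
      cases b <;> simp)
    (fun l t => (∀ q' ∈ t, ∃ l₁, l₁ <+ l ∧ l₁ ≠ [] ∧ q' = q l₁) ∧ (∀ q' ∈ t, q' ⊆ q l) ∧
      t.Pairwise (fun a b => b ⊆ a)) (by simp) (by
      rintro l hl l' hs _ t ⟨ht1, ht2, ht3⟩
      have ht2' : ∀ q' ∈ t, q' ⊆ q l := fun q' hq' => (ht2 q' hq').trans (hmono _ _ hs)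
      refine ⟨?_, ?_, List.pairwise_cons.2 ⟨ht2', ht3⟩⟩
      · intro q' hq'
        rcases List.mem_cons.1 hq' with rfl | hq'
        · exact ⟨l, List.Sublist.refl l, hl, rfl⟩
        · obtain ⟨l₁, h1, h2, h3⟩ := ht1 q' hq'
          exact ⟨l₁, h1.trans hs, h2, h3⟩
      · intro q' hq'
        rcases List.mem_cons.1 hq' with rfl | hq'
        · exact Finset.Subset.refl _
        · exact ht2' q' hq')
  refine no_idx_poset _ (fun s => ?_) _ ?_ h3
  · ext x; simp only [flipB_image, flipB_flipB]
  rintro t ⟨l, ⟨l₀, ⟨_, hl₀⟩, hl1, hl2⟩, _, _, ht1, _, ht3⟩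
  refine ⟨fun q' hq' => ?_, ht3⟩
  obtain ⟨l₁, hs, hne, rfl⟩ := ht1 q' hq'
  have hnonempty : (q l₁).Nonempty := by
    obtain ⟨y, hy⟩ := List.exists_mem_of_ne_nil l₁ hne
    have h4 := hl₀ y (hl1 y (hs.subset hy))
    have : ∃ j, ε < |y j| := by
      by_contra hcon
      push Not at hcon
      exact absurd ((pi_norm_le_iff_of_nonneg hε.le).2 hcon) (not_le.2 h4)
    obtain ⟨j, hj⟩ := this
    rcases lt_abs.1 hj with hj | hj
    · exact ⟨(j, true), (hqm _ _).2 ⟨y, hy, by simpa using hj⟩⟩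
    · exact ⟨(j, false), (hqm _ _).2 ⟨y, hy, by simpa using hj⟩⟩
  have hcons : ∀ x ∈ q l₁, flipB x ∉ q l₁ := by
    have aux : ∀ j, (j, true) ∈ q l₁ → (j, false) ∉ q l₁ := by
      intro j h1 h2
      obtain ⟨y, hy, h1⟩ := (hqm _ _).1 h1
      obtain ⟨z, hz, h2⟩ := (hqm _ _).1 h2
      simp only [if_true, Bool.false_eq_true, if_false] at h1 h2
      have h5 := hl2 y (hs.subset hy) z (hs.subset hz)
      have h6 := dist_le_pi_dist y z j
      rw [Real.dist_eq] at h6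
      have := le_abs_self (y j - z j)
      linarith
    rintro ⟨j, b⟩ h1 h2
    cases b
    · exact aux j h2 h1
    · exact aux j h1 h2
  refine ⟨hnonempty, ?_, flipB_ne _ hnonempty hcons⟩
  have hinj : Set.InjOn Prod.fst (q l₁ : Set (Fin n × Bool)) := by
    rintro ⟨j, b⟩ h1 ⟨j', b'⟩ h2 hjj
    simp only at hjj
    subst hjj
    by_cases hb : b' = !b
    · subst hb
      exact absurd h2 (hcons _ h1)
    · congr 1
      cases b <;> cases b' <;> simp_all
  rw [← Finset.card_image_of_injOn hinj]
  simpa using Finset.card_le_univ ((q l₁).image Prod.fst)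

end
end GPW

namespace GPW
open scoped List
noncomputable section

section carrier
variable {ι : Type*} [Fintype ι] [DecidableEq ι] {μ : Finset ι → ℕ} {E : Type*}

lemma flip_fst (S : Finset (ι × Bool)) : (S.image flipB).image Prod.fst = S.image Prod.fst := by
  ext i
  simp only [Finset.mem_image, flipB]
  constructor
  · rintro ⟨_, ⟨x, hx, rfl⟩, rfl⟩; exact ⟨x, hx, rfl⟩
  · rintro ⟨x, hx, rfl⟩; exact ⟨_, ⟨x, hx, rfl⟩, rfl⟩

lemma flip_flip (S : Finset (ι × Bool)) : (S.image flipB).image flipB = S := by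
  ext x; simp only [flipB_image, flipB_flipB]

/-- good lists of signed sets -/
def Good (μ : Finset ι → ℕ) (n : ℕ) (K : Set E) (Su : E → Finset (ι × Bool))
    (T : List (Finset (ι × Bool))) : Prop :=
  (T ≠ [] → ∃ y ∈ K, ∀ S ∈ T, S ⊆ Su y) ∧ ∀ S ∈ T, n + 1 ≤ μ (S.image Prod.fst)

/-- carrier of a list of signed sets -/
def Car (μ : Finset ι → ℕ) (T : List (Finset (ι × Bool))) (l : List (ι × Bool)) : Prop :=
  (∀ x ∈ l, ∃ S ∈ T, x ∈ S) ∧ l.map Prod.fst <+ (Finset.univ : Finset ι).toList ∧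
    Ind μ (l.map Prod.fst)

variable {n : ℕ} {K : Set E} {Su : E → Finset (ι × Bool)}

lemma Good.sublist {T T' : List (Finset (ι × Bool))} (h : Good μ n K Su T) (hs : T' <+ T) :
    Good μ n K Su T' := by
  refine ⟨fun hne => ?_, fun S hS => h.2 S (hs.subset hS)⟩
  obtain ⟨y, hy, hy'⟩ := h.1 (by rintro rfl; exact hne (List.sublist_nil.1 hs))
  exact ⟨y, hy, fun S hS => hy' S (hs.subset hS)⟩

lemma Car.mono {T T' : List (Finset (ι × Bool))} {l : List (ι × Bool)} (h : Car μ T' l)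
    (hs : T' <+ T) : Car μ T l := by
  refine ⟨fun x hx => ?_, h.2⟩
  obtain ⟨S, hS, hxS⟩ := h.1 x hx
  exact ⟨S, hs.subset hS, hxS⟩

lemma Car.flip {T : List (Finset (ι × Bool))} {l : List (ι × Bool)} (h : Car μ T l) :
    Car μ (T.map (fun S => S.image flipB)) (l.map flipB) := by
  have hf : (l.map flipB).map Prod.fst = l.map Prod.fst := by
    rw [List.map_map]; rfl
  refine ⟨fun x hx => ?_, by rw [hf]; exact h.2.1, by rw [hf]; exact h.2.2⟩
  obtain ⟨x', hx', rfl⟩ := List.mem_map.1 hx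
  obtain ⟨S, hS, hxS⟩ := h.1 x' hx'
  exact ⟨_, List.mem_map_of_mem hS, Finset.mem_image_of_mem _ hxS⟩

lemma Good.flip [Neg E] (hKneg : ∀ y ∈ K, -y ∈ K) (hneg : ∀ y, Su (-y) = (Su y).image flipB)
    {T : List (Finset (ι × Bool))} (h : Good μ n K Su T) :
    Good μ n K Su (T.map (fun S => S.image flipB)) := by
  refine ⟨fun hne => ?_, fun S hS => ?_⟩
  · obtain ⟨y, hy, hy'⟩ := h.1 (by rintro rfl; simp at hne)
    refine ⟨-y, hKneg y hy, fun S hS => ?_⟩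
    obtain ⟨S', hS', rfl⟩ := List.mem_map.1 hS
    rw [hneg]
    exact Finset.image_subset_image (hy' S' hS')
  · obtain ⟨S', hS', rfl⟩ := List.mem_map.1 hS
    rw [flip_fst]; exact h.2 S' hS'

lemma fill_signed (hμ : IsMatroidRankFn μ)
    (hcons : ∀ y ∈ K, ∀ x ∈ Su y, flipB x ∉ Su y) {T : List (Finset (ι × Bool))}
    (hT : Good μ n K Su T) (hne : T ≠ []) {m : ℕ} (hm : m ≤ n) (z : Ch (ι × Bool))
    (hz : z ∈ Sp (fun l => Car μ T l ∧ l.length = m)) (hbz : bd z = 0) :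
    ∃ c ∈ Sp (fun l => Car μ T l ∧ l.length = m + 1), bd c = z := by
  classical
  obtain ⟨y, hy, hTy⟩ := hT.1 hne
  set p : ι → Bool := fun i => decide (∃ S ∈ T, ∃ b, (i, b) ∈ S) with hp
  set L := (Finset.univ : Finset ι).toList.filter p with hL
  have hLmem : ∀ i, i ∈ L ↔ ∃ S ∈ T, ∃ b, (i, b) ∈ S := by
    intro i; simp [hL, hp]
  set sg : ι → ι × Bool := fun i => (i, decide (∃ S ∈ T, (i, true) ∈ S)) with hsg
  have hsgm : ∀ i ∈ L, ∃ S ∈ T, sg i ∈ S := by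
    intro i hi
    obtain ⟨S, hS, b, hb⟩ := (hLmem i).1 hi
    by_cases h : ∃ S ∈ T, (i, true) ∈ S
    · simpa [hsg, h] using h
    · cases b with
      | true => exact absurd ⟨S, hS, hb⟩ h
      | false => exact ⟨S, hS, by simpa [hsg, h] using hb⟩
  have hsgf : ∀ x : ι × Bool, (∃ S ∈ T, x ∈ S) → sg x.1 = x := by
    rintro ⟨i, b⟩ ⟨S, hS, hx⟩
    cases b with
    | true =>
      have : ∃ S ∈ T, (i, true) ∈ S := ⟨S, hS, hx⟩
      simp [hsg, this]
    | false =>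
      have : ¬ ∃ S ∈ T, (i, true) ∈ S := by
        rintro ⟨S', hS', hx'⟩
        exact hcons y hy _ (hTy S hS hx) (hTy S' hS' hx')
      simp only [hsg, this, decide_false]
  obtain ⟨c, hc, hbc⟩ := fill hμ L ((Finset.nodup_toList _).filter _) [] (m + 1) (mp Prod.fst z)
    (by
      refine map_mem (fun l h => ?_) hz
      rw [mp_dl]
      refine dl_mem ⟨?_, by simp [h.2], by simpa using h.1.2.2⟩
      have h1 := h.1.2.1.filter p
      have h2 : (l.map Prod.fst).filter p = l.map Prod.fst := by
        rw [List.filter_eq_self]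
        intro i hi
        obtain ⟨x, hx, rfl⟩ := List.mem_map.1 hi
        obtain ⟨S, hS, hxS⟩ := h.1.1 x hx
        simp only [hp, decide_eq_true_eq]
        exact ⟨S, hS, x.2, hxS⟩
      rwa [h2] at h1)
    (by rw [← mp_bd, hbz, map_zero])
    (by
      obtain ⟨S, hS⟩ := List.exists_mem_of_ne_nil T hne
      have h1 := hT.2 S hS
      have h2 : μ (S.image Prod.fst) ≤ μ L.toFinset := by
        apply rk_mono hμ
        intro i hi
        obtain ⟨x, hx, rfl⟩ := Finset.mem_image.1 hi
        rw [List.mem_toFinset, hLmem]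
        exact ⟨S, hS, x.2, hx⟩
      simp only [List.length_nil, List.nil_append]
      omega)
  have hsf : ∀ l : List ι, (l.map sg).map Prod.fst = l := by
    intro l; rw [List.map_map]
    have : Prod.fst ∘ sg = id := rfl
    rw [this, List.map_id]
  refine ⟨mp sg c, ?_, ?_⟩
  · refine map_mem (fun l h => ?_) hc
    rw [mp_dl]
    refine dl_mem ⟨⟨fun x hx => ?_, ?_, ?_⟩, by simp [h.2.1]⟩
    · obtain ⟨i, hi, rfl⟩ := List.mem_map.1 hx
      exact hsgm i (h.1.subset hi)
    · rw [hsf]; exact h.1.trans List.filter_sublist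
    · rw [hsf]; simpa using h.2.2
  · rw [← mp_bd, hbc, mp_mp]
    refine map_eq (F := mp (sg ∘ Prod.fst)) (G := LinearMap.id) (fun l h => ?_) hz
    simp only [mp_dl, LinearMap.id_apply]
    congr 1
    conv_rhs => rw [← List.map_id l]
    exact List.map_congr_left (fun x hx => hsgf x (h.1.1 x hx))

set_option maxHeartbeats 1000000 in
lemma exists_chain_map [Neg E] (hμ : IsMatroidRankFn μ) (hKneg : ∀ y ∈ K, -y ∈ K)
    (hneg : ∀ y, Su (-y) = (Su y).image flipB)
    (hcons : ∀ y ∈ K, ∀ x ∈ Su y, flipB x ∉ Su y) (m : ℕ) : m ≤ n + 1 →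
    ∃ ψ : List (Finset (ι × Bool)) → Ch (ι × Bool), ψ [] = dl [] ∧
      ∀ T, Good μ n K Su T → T.length ≤ m → bd (ψ T) = lin ψ (bdL T) ∧
        ψ T ∈ Sp (fun l => Car μ T l ∧ l.length = T.length) ∧
        ψ (T.map (fun S => S.image flipB)) = mp flipB (ψ T) := by
  induction m with
  | zero =>
    intro _
    refine ⟨fun _ => dl [], rfl, fun T _ hT => ?_⟩
    have : T = [] := by simpa using hT
    subst this
    refine ⟨by simp [bdL], dl_mem ⟨⟨by simp, by simp, ?_⟩, rfl⟩, by simp⟩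
    simpa [Ind] using hμ.1
  | succ m ih =>
    intro hm
    obtain ⟨ψ, h0, hψ⟩ := ih (by omega)
    have hττ : ∀ T : List (Finset (ι × Bool)), List.map (fun S => S.image flipB)
        (List.map (fun S => S.image flipB) T) = T := fun T => by
      rw [List.map_map]
      conv_rhs => rw [← List.map_id T]
      exact List.map_congr_left (fun S _ => flip_flip S)
    have hσσ : ∀ c : Ch (ι × Bool), mp flipB (mp flipB c) = c := fun c => by
      rw [mp_mp]
      have : mp (flipB ∘ flipB) = (LinearMap.id : Ch (ι × Bool) →ₗ[ZMod 2] _) := by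
        apply hom_ext
        intro l
        have : (flipB ∘ flipB : ι × Bool → ι × Bool) = id := funext flipB_flipB
        simp [this]
      rw [this]; rfl
    have hfree : ∀ T : List (Finset (ι × Bool)), (Good μ n K Su T ∧ T.length = m + 1) →
        List.map (fun S => S.image flipB) T ≠ T := fun T h heq => by
      obtain ⟨S, T', rfl⟩ := List.exists_cons_of_length_eq_add_one h.2
      obtain ⟨y, hy, hTy⟩ := h.1.1 (by simp)
      have hS : S.image flipB = S := by
        rw [List.map_cons] at heq
        exact (List.cons.inj heq).1
      refine flipB_ne S ?_ ?_ hS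
      · have h1 := h.1.2 S (by simp)
        rw [Finset.nonempty_iff_ne_empty]
        rintro rfl
        rw [Finset.image_empty, hμ.1] at h1
        omega
      · intro x hx hx'
        exact hcons y hy x (hTy S (by simp) hx) (hTy S (by simp) hx')
    have hR : ∀ (T : List (Finset (ι × Bool))) (c : Ch (ι × Bool)),
        (Good μ n K Su T ∧ T.length = m + 1) →
        (bd c = lin ψ (bdL T) ∧ c ∈ Sp (fun l => Car μ T l ∧ l.length = m + 1)) →
        (bd (mp flipB c) = lin ψ (bdL (List.map (fun S => S.image flipB) T)) ∧
          mp flipB c ∈ Sp (fun l => Car μ (List.map (fun S => S.image flipB) T) l ∧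
            l.length = m + 1)) := fun T c hT hc => by
      refine ⟨?_, ?_⟩
      · rw [← mp_bd, hc.1, ← mp_bdL]
        have key : (mp flipB ∘ₗ lin ψ) (bdL T) =
            (lin ψ ∘ₗ mp (fun S : Finset (ι × Bool) => S.image flipB)) (bdL T) := by
          refine map_eq (fun T' h => ?_) (bdL_mem T)
          have h5 := (hψ T' (hT.1.sublist h.1) (by omega)).2.2
          rw [LinearMap.comp_apply, LinearMap.comp_apply, mp_dl, lin_dl, lin_dl]
          exact h5.symm
        rw [LinearMap.comp_apply, LinearMap.comp_apply] at key
        exact key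
      · refine map_mem (fun l h => ?_) hc.2
        rw [mp_dl]
        exact dl_mem ⟨h.1.flip, by rw [List.length_map]; exact h.2⟩
    have hex : ∀ T : List (Finset (ι × Bool)), (Good μ n K Su T ∧ T.length = m + 1) →
        ∃ c, bd c = lin ψ (bdL T) ∧ c ∈ Sp (fun l => Car μ T l ∧ l.length = m + 1) :=
      fun T hT => by
        have hne : T ≠ [] := by rintro rfl; simp at hT
        have hz1 : lin ψ (bdL T) ∈ Sp (fun l => Car μ T l ∧ l.length = m) := by
          refine map_mem (fun T' h => ?_) (bdL_mem T)
          rw [lin_dl]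
          have hlen : T'.length = m := by omega
          refine Sp_mono (fun l hl => ⟨hl.1.mono h.1, hl.2.trans hlen⟩)
            (hψ T' (hT.1.sublist h.1) (by omega)).2.1
        have hz2 : bd (lin ψ (bdL T)) = 0 := by
          have : (bd ∘ₗ lin ψ) (bdL T) = (lin ψ ∘ₗ bd) (bdL T) := by
            refine map_eq (fun T' h => ?_) (bdL_mem T)
            have h5 := (hψ T' (hT.1.sublist h.1) (by omega)).1
            rw [LinearMap.comp_apply, LinearMap.comp_apply, lin_dl, bd_dl]
            exact h5
          rw [LinearMap.comp_apply, LinearMap.comp_apply, bd_bdL, map_zero] at this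
          exact this
        obtain ⟨c, hc, hbc⟩ := fill_signed hμ hcons hT.1 hne (m := m) (by omega) _ hz1 hz2
        exact ⟨c, hbc, hc⟩
    obtain ⟨f, hf⟩ := equivariant_choice (D := List (Finset (ι × Bool))) (Y := Ch (ι × Bool))
      (List.map (fun S => S.image flipB)) (mp flipB) hττ hσσ
      (fun T => Good μ n K Su T ∧ T.length = m + 1)
      (fun T h => ⟨h.1.flip hKneg hneg, by rw [List.length_map]; exact h.2⟩) hfree
      (fun T c => bd c = lin ψ (bdL T) ∧ c ∈ Sp (fun l => Car μ T l ∧ l.length = m + 1))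
      hR hex
    refine ⟨fun T => if T.length = m + 1 then f T else ψ T, by simpa using h0, fun T hT hlen => ?_⟩
    have hlin : lin (fun T => if T.length = m + 1 then f T else ψ T) (bdL T) = lin ψ (bdL T) := by
      refine map_eq (fun T' h => ?_) (bdL_mem T)
      have : T'.length ≠ m + 1 := by omega
      simp [this]
    rw [hlin]
    by_cases hTm : T.length = m + 1
    · obtain ⟨⟨h1, h2⟩, h3⟩ := hf T ⟨hT, hTm⟩
      simp only [hTm, if_true, List.length_map]
      exact ⟨h1, h2, h3⟩
    · simp only [hTm, if_false, List.length_map]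
      exact hψ T hT (by omega)

end carrier

/-- The topological core. -/
theorem core {ι : Type*} [Fintype ι] [DecidableEq ι] {μ : Finset ι → ℕ} (hμ : IsMatroidRankFn μ)
    {n : ℕ} (Su : (Fin (n + 1) → ℝ) → Finset (ι × Bool))
    (hopen : ∀ y, ∀ᶠ z in nhds y, Su y ⊆ Su z)
    (hneg : ∀ y, Su (-y) = (Su y).image flipB)
    (hcons : ∀ y, ∑ j, |y j| = 1 → ∀ x ∈ Su y, flipB x ∉ Su y)
    (hrank : ∀ y, ∑ j, |y j| = 1 → n + 1 ≤ μ ((Su y).image Prod.fst)) :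
    HasIdx flipB (fun l => ∃ y, (∀ x ∈ l, x ∈ Su y) ∧ Ind μ (l.map Prod.fst)) n := by
  classical
  set K : Set (Fin (n + 1) → ℝ) := {y | ∑ j, |y j| = 1} with hK
  have hKneg : ∀ y ∈ K, -y ∈ K := by
    intro y (hy : ∑ j, |y j| = 1)
    show ∑ j, |(-y) j| = 1
    simpa using hy
  have hKc : IsCompact K := by
    refine Metric.isCompact_of_isClosed_isBounded ?_ ?_
    · exact isClosed_eq (by fun_prop) continuous_const
    · refine (Metric.isBounded_closedBall (x := (0 : Fin (n + 1) → ℝ)) (r := 1)).subset ?_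
      intro y (hy : ∑ j, |y j| = 1)
      rw [Metric.mem_closedBall, dist_zero_right, pi_norm_le_iff_of_nonneg zero_le_one]
      intro i
      rw [← hy, Real.norm_eq_abs]
      exact Finset.single_le_sum (f := fun j => |y j|) (fun j _ => abs_nonneg _) (Finset.mem_univ i)
  obtain ⟨δ, hδ, hleb⟩ := lebesgue_number_lemma_of_metric (s := K)
    (c := fun y : K => interior {z | Su y ⊆ Su z}) hKc (fun _ => isOpen_interior)
    (fun y hy => Set.mem_iUnion.2 ⟨⟨y, hy⟩, mem_interior_iff_mem_nhds.2 (hopen y)⟩)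
  have h1 := (idx_cross n).small hδ
  let b : List (Fin (n + 1) → ℝ) → Finset (ι × Bool) := fun l =>
    Finset.univ.filter (fun x => ∀ y ∈ l, x ∈ Su y)
  have hb : ∀ l x, x ∈ b l ↔ ∀ y ∈ l, x ∈ Su y := by intro l x; simp [b]
  have h2 := h1.sd b (τ' := fun S => S.image flipB) (fun l _ => by
      ext x
      rw [flipB_image, hb, hb]
      simp only [List.mem_map, forall_exists_index, and_imp, forall_apply_eq_imp_iff₂, hneg,
        flipB_image])
    (fun l t => (∀ S ∈ t, ∃ l₁, l₁ <+ l ∧ l₁ ≠ [] ∧ S = b l₁) ∧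
      (t ≠ [] → ∃ x ∈ l, ∀ S ∈ t, S ⊆ Su x)) (by simp) (by
      rintro l hl l' hs _ t ⟨ht1, ht2⟩
      have hbx : ∀ x ∈ l, b l ⊆ Su x := fun x hx z hz => (hb l z).1 hz x hx
      refine ⟨?_, fun _ => ?_⟩
      · intro S hS
        rcases List.mem_cons.1 hS with rfl | hS
        · exact ⟨l, List.Sublist.refl l, hl, rfl⟩
        · obtain ⟨l₁, h1, h2, h3⟩ := ht1 S hS
          exact ⟨l₁, h1.trans hs, h2, h3⟩
      · by_cases htn : t = []
        · obtain ⟨x, hx⟩ := List.exists_mem_of_ne_nil l hl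
          subst htn
          exact ⟨x, hx, by simpa using hbx x hx⟩
        · obtain ⟨x, hx, hxS⟩ := ht2 htn
          refine ⟨x, hs.subset hx, fun S hS => ?_⟩
          rcases List.mem_cons.1 hS with rfl | hS
          · exact hbx x (hs.subset hx)
          · exact hxS S hS)
  have h3 : HasIdx (fun S : Finset (ι × Bool) => S.image flipB) (Good μ n K Su) n := by
    refine h2.mono ?_
    rintro t ⟨l, ⟨l₀, hl₀, hl1, hl2⟩, _, _, ht1, ht2⟩
    have hlK : ∀ x ∈ l, x ∈ K := fun x hx => hl₀ (hl1 x hx)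
    refine ⟨fun hne => ?_, fun S hS => ?_⟩
    · obtain ⟨x, hx, hxS⟩ := ht2 hne
      exact ⟨x, hlK x hx, hxS⟩
    · obtain ⟨l₁, hs, hne, rfl⟩ := ht1 S hS
      obtain ⟨x, hx⟩ := List.exists_mem_of_ne_nil l₁ hne
      obtain ⟨⟨y, hy⟩, hball⟩ := hleb x (hlK x (hs.subset hx))
      refine (hrank y hy).trans (rk_mono hμ (Finset.image_subset_image ?_))
      intro z hz
      rw [hb]
      intro x' hx'
      have : x' ∈ {z | Su y ⊆ Su z} := interior_subset (hball (by
        rw [Metric.mem_ball]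
        exact hl2 x' (hs.subset hx') x (hs.subset hx)))
      exact this hz
  obtain ⟨ψ, h0, hψ⟩ := exists_chain_map (n := n) (K := K) (Su := Su) hμ hKneg hneg
    (fun y hy => hcons y hy) (n + 1) le_rfl
  refine h3.map (lin ψ) (by simpa using h0) (fun T hT hlen => ?_) (fun T hT hlen _ => ?_)
    (fun T hT hlen hne => ?_)
  · rw [lin_dl]; exact (hψ T hT hlen).1.symm
  · rw [lin_dl, lin_dl]; exact (hψ T hT hlen).2.2
  · rw [lin_dl]
    refine Sp_mono (fun l hl => ⟨?_, hl.2⟩) (hψ T hT hlen).2.1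
    obtain ⟨y, hy, hTy⟩ := hT.1 hne
    refine ⟨y, fun x hx => ?_, hl.1.2.2⟩
    obtain ⟨S, hS, hxS⟩ := hl.1.1 x hx
    exact hTy S hS hxS

end
end GPW

namespace GPW
open scoped List
noncomputable section

lemma rk_le_card {ι : Type*} [DecidableEq ι] {μ : Finset ι → ℕ} (hμ : IsMatroidRankFn μ)
    (S : Finset ι) : μ S ≤ S.card := by
  have := rk_le_length hμ S.toList
  simpa using this

/-- Replace the sets by finite subsets which witness all intersections of hulls. -/
lemma finite_reduction {ι E : Type*} [Fintype ι] [AddCommGroup E] [Module ℝ E]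
    (A : ι → Set E) (hne : ∀ i, (A i).Nonempty) :
    ∃ P : ι → Set E, (∀ i, P i ⊆ A i) ∧ (∀ i, (P i).Finite) ∧ (∀ i, (P i).Nonempty) ∧
      ∀ G₁ G₂ : Finset ι,
        (convexHull ℝ (⋃ i ∈ G₁, A i) ∩ convexHull ℝ (⋃ i ∈ G₂, A i)).Nonempty →
        (convexHull ℝ (⋃ i ∈ G₁, P i) ∩ convexHull ℝ (⋃ i ∈ G₂, P i)).Nonempty := by
  classical
  have key : ∀ G : Finset ι × Finset ι, ∃ t : Finset E,
      (convexHull ℝ (⋃ i ∈ G.1, A i) ∩ convexHull ℝ (⋃ i ∈ G.2, A i)).Nonempty →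
      (convexHull ℝ (↑t ∩ ⋃ i ∈ G.1, A i) ∩ convexHull ℝ (↑t ∩ ⋃ i ∈ G.2, A i)).Nonempty := by
    intro G
    by_cases h : (convexHull ℝ (⋃ i ∈ G.1, A i) ∩ convexHull ℝ (⋃ i ∈ G.2, A i)).Nonempty
    · obtain ⟨x, hx1, hx2⟩ := h
      rw [convexHull_eq_union_convexHull_finite_subsets] at hx1 hx2
      simp only [Set.mem_iUnion] at hx1 hx2
      obtain ⟨t1, ht1, hx1⟩ := hx1
      obtain ⟨t2, ht2, hx2⟩ := hx2
      refine ⟨t1 ∪ t2, fun _ => ⟨x, convexHull_mono ?_ hx1, convexHull_mono ?_ hx2⟩⟩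
      · intro z hz
        exact ⟨by rw [Finset.coe_union]; exact Or.inl hz, by simpa using ht1 hz⟩
      · intro z hz
        exact ⟨by rw [Finset.coe_union]; exact Or.inr hz, by simpa using ht2 hz⟩
    · exact ⟨∅, fun h' => absurd h' h⟩
  choose t ht using key
  choose pt hpt using hne
  refine ⟨fun i => ((Finset.univ.image pt ∪ Finset.univ.biUnion t : Finset E) : Set E) ∩ A i,
    fun i => Set.inter_subset_right, fun i => (Finset.finite_toSet _).inter_of_left _,
    fun i => ⟨pt i, by simp, hpt i⟩, fun G₁ G₂ h => ?_⟩
  have hsub : ∀ G : Finset ι, ((t (G₁, G₂) : Set E) ∩ ⋃ i ∈ G, A i) ⊆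
      ⋃ i ∈ G, (((Finset.univ.image pt ∪ Finset.univ.biUnion t : Finset E) : Set E) ∩ A i) := by
    rintro G z ⟨hz1, hz2⟩
    simp only [Set.mem_iUnion] at hz2 ⊢
    obtain ⟨i, hi, hz2⟩ := hz2
    refine ⟨i, hi, ?_, hz2⟩
    rw [Finset.mem_coe, Finset.mem_union]
    exact Or.inr (Finset.mem_biUnion.2 ⟨_, Finset.mem_univ _, hz1⟩)
  obtain ⟨x, h1, h2⟩ := ht (G₁, G₂) h
  exact ⟨x, convexHull_mono (hsub G₁) h1, convexHull_mono (hsub G₂) h2⟩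

/-- lifted signed vector -/
def sv {ι : Type*} {k : ℕ} (φ : ι → EuclideanSpace ℝ (Fin k)) (x : ι × Bool) : Fin (k + 1) → ℝ :=
  (if x.2 then (1 : ℝ) else -1) • (Fin.cons 1 (fun j => φ x.1 j) : Fin (k + 1) → ℝ)

lemma sv_flip {ι : Type*} {k : ℕ} (φ : ι → EuclideanSpace ℝ (Fin k)) (x : ι × Bool) :
    sv φ (flipB x) = - sv φ x := by
  obtain ⟨i, b⟩ := x
  cases b <;> simp [sv, flipB]

lemma sv_hull {ι : Type*} {k : ℕ} (φ : ι → EuclideanSpace ℝ (Fin k)) (l : List (ι × Bool))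
    (h : convexHull ℝ (φ '' {i | (i, true) ∈ l}) ∩ convexHull ℝ (φ '' {i | (i, false) ∈ l}) = ∅) :
    (0 : Fin (k + 1) → ℝ) ∉ hull (l.map (sv φ)) := by
  have hfin : ∀ b, {i | (i, b) ∈ l}.Finite := fun b =>
    ((List.finite_toSet l).image Prod.fst).subset (fun i hi => ⟨(i, b), hi, rfl⟩)
  obtain ⟨f, u, v, h1, huv, h2⟩ := geometric_hahn_banach_compact_closed (convex_convexHull ℝ _)
    (((hfin true).image φ).isCompact_convexHull ℝ) (convex_convexHull ℝ _)
    (((hfin false).image φ).isCompact_convexHull ℝ).isClosed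
    (Set.disjoint_iff_inter_eq_empty.2 h)
  let g : (Fin (k + 1) → ℝ) → ℝ := fun y => f (WithLp.toLp 2 (Fin.tail y)) - u * y 0
  have hg : IsLinearMap ℝ g := by
    constructor
    · intro y z
      have : WithLp.toLp 2 (Fin.tail (y + z)) = WithLp.toLp 2 (Fin.tail y) +
        (WithLp.toLp 2 (Fin.tail z) : EuclideanSpace ℝ (Fin k)) := rfl
      simp only [g, this, map_add, Pi.add_apply]; ring
    · intro c y
      have : WithLp.toLp 2 (Fin.tail (c • y)) =
        c • (WithLp.toLp 2 (Fin.tail y) : EuclideanSpace ℝ (Fin k)) := rfl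
      simp only [g, this, map_smul, Pi.smul_apply, smul_eq_mul]; ring
  have hsub : hull (l.map (sv φ)) ⊆ {y | g y < 0} := by
    refine convexHull_min ?_ (convex_halfSpace_lt hg 0)
    intro y hy
    obtain ⟨⟨i, b⟩, hx, rfl⟩ := List.mem_map.1 hy
    have hgi : g (Fin.cons 1 (fun j => φ i j)) = f (φ i) - u := by
      simp only [g, Fin.tail_cons, Fin.cons_zero, mul_one]
    show g (sv φ (i, b)) < 0
    rw [sv, hg.map_smul, hgi]
    cases b with
    | true =>
      have := h1 _ (subset_convexHull ℝ _ ⟨i, hx, rfl⟩)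
      simp only [if_true, one_smul]; linarith
    | false =>
      have := h2 _ (subset_convexHull ℝ _ ⟨i, hx, rfl⟩)
      simp; linarith
  intro h0
  have : g 0 < 0 := hsub h0
  rw [hg.map_zero] at this
  exact lt_irrefl _ this

section main
variable {d k : ℕ}

/-- normal vector -/
def nv (d k : ℕ) : (Fin (k + 2) → ℝ) →ₗ[ℝ] EuclideanSpace ℝ (Fin d) where
  toFun y := WithLp.toLp 2 (fun j : Fin d => if h : j.val ≤ k then y ⟨j.val + 1, by omega⟩ else 0)
  map_add' y z := by
    ext j; by_cases h : j.val ≤ k <;> simp [h]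
  map_smul' c y := by
    ext j; by_cases h : j.val ≤ k <;> simp [h]

/-- affine functional -/
def af (y : Fin (k + 2) → ℝ) (x : EuclideanSpace ℝ (Fin d)) : ℝ := ⟪x, nv d k y⟫ - y 0

lemma af_neg (y : Fin (k + 2) → ℝ) (x : EuclideanSpace ℝ (Fin d)) : af (-y) x = - af y x := by
  simp only [af, map_neg, inner_neg_right, Pi.neg_apply]; ring

lemma af_cont (x : EuclideanSpace ℝ (Fin d)) : Continuous (fun y : Fin (k + 2) → ℝ => af y x) := by
  have h : Continuous (nv d k) := LinearMap.continuous_of_finiteDimensional _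
  unfold af
  fun_prop

lemma nv_zero (hkd : k < d) (y : Fin (k + 2) → ℝ) (h : nv d k y = 0) (j : Fin (k + 2))
    (hj : j ≠ 0) : y j = 0 := by
  obtain ⟨j, rfl⟩ := Fin.exists_succ_eq.2 hj
  have h1 := congrArg (fun v : EuclideanSpace ℝ (Fin d) => v ⟨j.val, by omega⟩) h
  simp only [nv, LinearMap.coe_mk, AddHom.coe_mk, PiLp.zero_apply] at h1
  rw [dif_pos (by have := j.isLt; omega)] at h1
  exact h1

open Classical in
/-- signed support -/
def Su {ι : Type*} [Fintype ι] (P : ι → Set (EuclideanSpace ℝ (Fin d))) (y : Fin (k + 2) → ℝ) :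
    Finset (ι × Bool) :=
  Finset.univ.filter (fun q => ∀ x ∈ P q.1, 0 < (if q.2 then (1 : ℝ) else -1) * af y x)

variable {ι : Type*} [Fintype ι] {P : ι → Set (EuclideanSpace ℝ (Fin d))}

lemma mem_Su {y : Fin (k + 2) → ℝ} {q : ι × Bool} : q ∈ Su P y ↔
    ∀ x ∈ P q.1, 0 < (if q.2 then (1 : ℝ) else -1) * af y x := by
  classical
  simp [Su]

lemma Su_open (hfin : ∀ i, (P i).Finite) (y : Fin (k + 2) → ℝ) :
    ∀ᶠ z in nhds y, Su P y ⊆ Su P z := by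
  have : ∀ᶠ z in nhds y, ∀ q ∈ Su P y, ∀ x ∈ P q.1,
      0 < (if q.2 then (1 : ℝ) else -1) * af z x := by
    rw [Filter.eventually_all_finset]
    intro q hq
    rw [Filter.eventually_all_finite (hfin q.1)]
    intro x hx
    have hc : Continuous (fun z : Fin (k + 2) → ℝ => (if q.2 then (1 : ℝ) else -1) * af z x) :=
      continuous_const.mul (af_cont x)
    exact hc.continuousAt.eventually (lt_mem_nhds (mem_Su.1 hq x hx))
  filter_upwards [this] with z hz q hq
  exact mem_Su.2 (hz q hq)

lemma Su_neg [DecidableEq ι] (y : Fin (k + 2) → ℝ) : Su P (-y) = (Su P y).image flipB := by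
  ext ⟨i, b⟩
  rw [flipB_image, mem_Su, mem_Su]
  refine forall₂_congr (fun x _ => ?_)
  rw [af_neg]
  cases b <;> simp [flipB]

lemma Su_cons (hne : ∀ i, (P i).Nonempty) (y : Fin (k + 2) → ℝ) (q : ι × Bool)
    (h : q ∈ Su P y) : flipB q ∉ Su P y := by
  intro h'
  obtain ⟨i, b⟩ := q
  obtain ⟨x, hx⟩ := hne i
  have h1 := mem_Su.1 h x hx
  have h2 := mem_Su.1 h' x hx
  cases b <;> simp [flipB] at h1 h2 <;> linarith

lemma Su_sep (l : List (ι × Bool)) (y : Fin (k + 2) → ℝ) (h : ∀ q ∈ l, q ∈ Su P y)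
    (G₁ G₂ : Finset ι) (h1 : ∀ i ∈ G₁, (i, true) ∈ l) (h2 : ∀ i ∈ G₂, (i, false) ∈ l) :
    convexHull ℝ (⋃ i ∈ G₁, P i) ∩ convexHull ℝ (⋃ i ∈ G₂, P i) = ∅ := by
  have hlin : IsLinearMap ℝ (fun x : EuclideanSpace ℝ (Fin d) => ⟪x, nv d k y⟫) :=
    ⟨fun a b => inner_add_left _ _ _, fun c a => by simp [inner_smul_left]⟩
  have e1 : convexHull ℝ (⋃ i ∈ G₁, P i) ⊆ {x | y 0 < ⟪x, nv d k y⟫} := by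
    refine convexHull_min ?_ (convex_halfSpace_gt hlin _)
    intro x hx
    simp only [Set.mem_iUnion] at hx
    obtain ⟨i, hi, hx⟩ := hx
    have := mem_Su.1 (h _ (h1 i hi)) x hx
    simp [af] at this
    exact this
  have e2 : convexHull ℝ (⋃ i ∈ G₂, P i) ⊆ {x | ⟪x, nv d k y⟫ < y 0} := by
    refine convexHull_min ?_ (convex_halfSpace_lt hlin _)
    intro x hx
    simp only [Set.mem_iUnion] at hx
    obtain ⟨i, hi, hx⟩ := hx
    have := mem_Su.1 (h _ (h2 i hi)) x hx
    simp [af] at this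
    exact this
  rw [Set.eq_empty_iff_forall_notMem]
  rintro x ⟨hx1, hx2⟩
  exact lt_asymm (show y 0 < ⟪x, nv d k y⟫ from e1 hx1) (e2 hx2)

lemma Su_hit {A : ι → Set (EuclideanSpace ℝ (Fin d))} (hconv : ∀ i, Convex ℝ (A i))
    (hPA : ∀ i, P i ⊆ A i) (y : Fin (k + 2) → ℝ) (i : ι) (ht : (i, true) ∉ Su P y)
    (hf : (i, false) ∉ Su P y) : (A i ∩ {x | ⟪x, nv d k y⟫ = y 0}).Nonempty := by
  rw [mem_Su] at ht hf
  push Not at ht hf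
  obtain ⟨x1, hx1, h1⟩ := ht
  obtain ⟨x2, hx2, h2⟩ := hf
  simp [af] at h1 h2
  have hc : ContinuousOn (fun x : EuclideanSpace ℝ (Fin d) => ⟪x, nv d k y⟫) (A i) := by fun_prop
  obtain ⟨x, hx, hx'⟩ := (hconv i).isPreconnected.intermediate_value (hPA i hx1) (hPA i hx2) hc
    ⟨h1, h2⟩
  exact ⟨x, hx, hx'⟩

end main

end
end GPW

open GPW in
theorem matroid_colorful_gpw
    {d k : ℕ} (hkd : k < d) {ι : Type*} [Fintype ι] [DecidableEq ι]
    (A : ι → Set (EuclideanSpace ℝ (Fin d)))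
    (hconv : ∀ i, Convex ℝ (A i)) (hne : ∀ i, (A i).Nonempty)
    (μ : Finset ι → ℕ) (hμ : IsMatroidRankFn μ) (hloopless : ∀ i : ι, μ {i} = 1)
    (φ : ι → EuclideanSpace ℝ (Fin k))
    (hφ : ∀ G₁ G₂ : Finset ι, Disjoint G₁ G₂ → μ (G₁ ∪ G₂) = G₁.card + G₂.card →
      convexHull ℝ (⋃ i ∈ G₁, A i) ∩ convexHull ℝ (⋃ i ∈ G₂, A i) = ∅ →
      convexHull ℝ (φ '' (G₁ : Set ι)) ∩ convexHull ℝ (φ '' (G₂ : Set ι)) = ∅) :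
    ∃ G : Finset ι, μ (Finset.univ \ G) ≤ k + 1 ∧
      ∃ (w : EuclideanSpace ℝ (Fin d)) (a : ℝ), w ≠ 0 ∧
        ∀ i ∈ G, (A i ∩ {x | ⟪x, w⟫ = a}).Nonempty := by
  by_contra hcon
  obtain ⟨P, hPA, hPfin, hPne, hPhull⟩ := finite_reduction A hne
  have huniv : k + 2 ≤ μ Finset.univ := by
    by_contra hlt
    refine hcon ⟨∅, by rw [Finset.sdiff_empty]; omega, EuclideanSpace.single ⟨0, by omega⟩ 1, 0,
      ?_, by simp⟩
    simp
  have hrank : ∀ y : Fin (k + 2) → ℝ, ∑ j, |y j| = 1 →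
      k + 1 + 1 ≤ μ ((Su P y).image Prod.fst) := by
    intro y hy
    by_cases hw : nv d k y = 0
    · have hy0 : y 0 ≠ 0 := by
        intro h0
        have : ∀ j, y j = 0 := fun j => by
          by_cases hj : j = 0
          · rw [hj, h0]
          · exact nv_zero hkd y hw j hj
        simp [this] at hy
      have : (Su P y).image Prod.fst = Finset.univ := by
        rw [Finset.eq_univ_iff_forall]
        intro i
        rw [Finset.mem_image]
        refine ⟨(i, decide (y 0 < 0)), ?_, rfl⟩
        rw [mem_Su]
        intro x _
        simp only [af, hw, inner_zero_right]
        rcases lt_or_gt_of_ne hy0 with h | h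
        · simp [h]
        · simp [h, not_lt.2 h.le]
      rw [this]; exact huniv
    · by_contra hlt
      refine hcon ⟨Finset.univ \ (Su P y).image Prod.fst, ?_, nv d k y, y 0, hw, fun i hi => ?_⟩
      · rw [sdiff_sdiff_right_self, Finset.inf_eq_inter, Finset.univ_inter]; omega
      · rw [Finset.mem_sdiff, Finset.mem_image] at hi
        refine Su_hit hconv hPA y i (fun h => hi.2 ⟨_, h, rfl⟩) (fun h => hi.2 ⟨_, h, rfl⟩)
  have hidx := core (n := k + 1) hμ (Su P) (Su_open hPfin) Su_neg
    (fun y _ q hq => Su_cons hPne y q hq) hrank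
  refine no_idx (k + 1) (hidx.map (mp (sv φ)) (by simp) (fun l _ _ => ?_) (fun l _ _ _ => ?_)
    (fun l hl _ _ => ?_))
  · rw [mp_bdL, mp_dl, bd_dl]
  · rw [mp_dl, mp_dl, mp_dl, List.map_map, List.map_map]
    congr 2
    funext x
    exact sv_flip φ x
  · rw [mp_dl]
    refine dl_mem ⟨sv_hull φ l ?_, by simp⟩
    obtain ⟨y, hly, hind⟩ := hl
    set G : Bool → Finset ι := fun b => Finset.univ.filter (fun i => (i, b) ∈ l) with hG
    have hGmem : ∀ b i, i ∈ G b ↔ (i, b) ∈ l := by intro b i; simp [hG]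
    have hGc : ∀ b, (G b : Set ι) = {i | (i, b) ∈ l} := by
      intro b; ext i; exact hGmem b i
    have hdis : Disjoint (G true) (G false) := by
      rw [Finset.disjoint_left]
      intro i h1 h2
      exact Su_cons hPne y _ (hly _ ((hGmem _ _).1 h1)) (hly _ ((hGmem _ _).1 h2))
    have hun : G true ∪ G false = (l.map Prod.fst).toFinset := by
      ext i
      simp [hGmem, or_comm]
    rw [← hGc, ← hGc]
    apply hφ _ _ hdis
    · rw [← Finset.card_union_of_disjoint hdis, hun]
      refine le_antisymm (rk_le_card hμ _) ?_
      rw [hind]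
      exact List.toFinset_card_le _
    · rw [← Set.not_nonempty_iff_eq_empty]
      intro hnon
      have := hPhull _ _ hnon
      rw [Su_sep l y hly _ _ (fun i hi => (hGmem _ _).1 hi) (fun i hi => (hGmem _ _).1 hi)] at this
      exact Set.not_nonempty_empty this
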